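/- Let 𝕀 be an area-minimal r-disk family consisting of n arcs. Then the area of 𝕀 equals exactly n·r/2. -/

import Mathlib

noncomputable section

/-- An arc of the circle `ℝ/cℤ`: the image of a closed interval `[a, b] ⊆ ℝ` with
`0 < b - a < c`. -/
structure Arc (c : ℝ) where
  /-- initial representative -/
  a : ℝ
  /-- terminal representative -/
  b : ℝ
  width_pos : 0 < b - a
  width_lt : b - a < c

namespace Arc

variable {c : ℝ}

/-- The underlying subset of the circle `ℝ/cℤ`. -/
def toSet (α : Arc c) : Set (AddCircle c) :=
  (fun x : ℝ => (x : AddCircle c)) '' Set.Icc α.a α.b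

/-- The interior of an arc: the image of the open interval `(a, b)`. -/
def interiorSet (α : Arc c) : Set (AddCircle c) :=
  (fun x : ℝ => (x : AddCircle c)) '' Set.Ioo α.a α.b

/-- The width `b - a` of an arc. -/
def width (α : Arc c) : ℝ := α.b - α.a

/-- The initial endpoint of an arc. -/
def init (α : Arc c) : AddCircle c := (α.a : AddCircle c)

/-- The terminal endpoint of an arc. -/
def term (α : Arc c) : AddCircle c := (α.b : AddCircle c)

/-- The two endpoints of an arc. -/
def endpoints (α : Arc c) : Set (AddCircle c) := {α.init, α.term}

/-- Two arcs are *adjacent* if they intersect in exactly one point, which is a common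
endpoint. -/
def Adjacent (α β : Arc c) : Prop :=
  ∃ p, α.toSet ∩ β.toSet = {p} ∧ p ∈ α.endpoints ∧ p ∈ β.endpoints

/-- Two arcs *share an endpoint* if some endpoint of one is an endpoint of the other. -/
def SharesEndpoint (α β : Arc c) : Prop := (α.endpoints ∩ β.endpoints).Nonempty

/-- Two arcs with no common endpoint *cross* if exactly one of the two endpoints of one
of them lies in the other. -/
def Crosses (α β : Arc c) : Prop :=
  ¬ SharesEndpoint α β ∧
    (Xor' (β.init ∈ α.toSet) (β.term ∈ α.toSet) ∨
      Xor' (α.init ∈ β.toSet) (α.term ∈ β.toSet))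

end Arc

/-- A finite family of arcs of the circle `ℝ/cℤ` (of circumference `c > 0`) is an
*`r`-disk family* if:
(i) no two arcs of the family have union equal to the whole circle;
(ii) every point of the circle that is not an endpoint of any arc of the family lies in
exactly `r` arcs of the family;
(iii) every point of the circle that is an endpoint of some arc of the family is the
terminal endpoint of exactly one arc and the initial endpoint of exactly one arc of the
family, and these two arcs intersect only in that point. -/
def IsDiskFamily (r : ℕ) {c : ℝ} (I : Finset (Arc c)) : Prop :=
  0 < c ∧
  (∀ α ∈ I, ∀ β ∈ I, α.toSet ∪ β.toSet ≠ Set.univ) ∧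
  (∀ p : AddCircle c, (∀ α ∈ I, p ∉ α.endpoints) →
    Nat.card {α : Arc c // α ∈ I ∧ p ∈ α.toSet} = r) ∧
  (∀ p : AddCircle c, (∃ α ∈ I, p ∈ α.endpoints) →
    Nat.card {α : Arc c // α ∈ I ∧ α.term = p} = 1 ∧
    Nat.card {α : Arc c // α ∈ I ∧ α.init = p} = 1 ∧
    (∀ α ∈ I, ∀ β ∈ I, α.term = p → β.init = p → α.toSet ∩ β.toSet = {p}))

/-- The *area* of a family of arcs: the number of unordered pairs of arcs that cross,
plus one half of the number of unordered pairs of arcs that share an endpoint.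
(It is computed here from the corresponding counts of ordered pairs.) -/
def diskArea {c : ℝ} (I : Finset (Arc c)) : ℝ :=
  (Nat.card {p : Arc c × Arc c // p.1 ∈ I ∧ p.2 ∈ I ∧ p.1.Crosses p.2} : ℝ) / 2 +
    (Nat.card {p : Arc c × Arc c //
      p.1 ∈ I ∧ p.2 ∈ I ∧ p.1 ≠ p.2 ∧ p.1.SharesEndpoint p.2} : ℝ) / 4

/-- An `r`-disk family is *area-minimal* if no `r`-disk family (on a circle of any
circumference) has strictly smaller area. -/
def IsAreaMinimal (r : ℕ) {c : ℝ} (I : Finset (Arc c)) : Prop :=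
  IsDiskFamily r I ∧
    ∀ (c' : ℝ) (J : Finset (Arc c')), IsDiskFamily r J → diskArea I ≤ diskArea J

section

open scoped Classical

/-- The real-line picture of an `r`-disk family: arcs are given by lifts `[a i, b i]`, which are
considered up to translation by integer multiples of `c`. -/
structure ArcSystem (ι : Type) [Fintype ι] (c : ℝ) (r : ℕ) where
  a : ι → ℝ
  b : ι → ℝ
  pos : 0 < c
  width_pos : ∀ i, a i < b i
  width_lt : ∀ i, b i < a i + c
  not_cover : ∀ i j (k l : ℤ), a j + l * c ≤ b i + k * c → b j + l * c < a i + k * c + c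
  coverage : ∀ x, (∀ i (k : ℤ), x ≠ a i + k * c ∧ x ≠ b i + k * c) →
    (Finset.univ.filter fun i => ∃ k : ℤ, a i + k * c < x ∧ x < b i + k * c).card = r
  exists_next : ∀ i, ∃ j, ∃ k : ℤ, a j + k * c = b i
  exists_prev : ∀ j, ∃ i, ∃ k : ℤ, b i + k * c = a j
  a_inj : ∀ i j (k l : ℤ), a i + k * c = a j + l * c → i = j
  b_inj : ∀ i j (k l : ℤ), b i + k * c = b j + l * c → i = j

theorem int_le_of_mul_lt {c : ℝ} (hc : 0 < c) {k l : ℤ} (h : (k : ℝ) * c < l * c + c) : k ≤ l := by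
  have h1 : (k : ℝ) < l + 1 := by
    by_contra hcon
    push Not at hcon
    nlinarith
  have h2 : k < l + 1 := by exact_mod_cast h1
  omega

/-- In a finite set, ranks with respect to an injective function sum to a triangular number. -/
theorem two_mul_sum_card_le {ι : Type} (S : Finset ι) (h : ι → ℝ) (hh : Set.InjOn h S) :
    2 * ∑ i ∈ S, ((S.filter fun j => h j ≤ h i).card : ℝ) = (S.card : ℝ) ^ 2 + S.card := by
  have e1 : ∀ i ∈ S, ((S.filter fun j => h j ≤ h i).card : ℝ)
      = ∑ j ∈ S, if h j ≤ h i then (1 : ℝ) else 0 := by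
    intro i _
    simp
  rw [Finset.sum_congr rfl e1, two_mul]
  nth_rewrite 2 [Finset.sum_comm]
  rw [← Finset.sum_add_distrib]
  have e2 : ∀ i ∈ S, ((∑ j ∈ S, if h j ≤ h i then (1 : ℝ) else 0) +
      ∑ j ∈ S, if h i ≤ h j then (1 : ℝ) else 0) = S.card + 1 := by
    intro i hi
    rw [← Finset.sum_add_distrib]
    have : ∀ j ∈ S, ((if h j ≤ h i then (1 : ℝ) else 0) + if h i ≤ h j then (1 : ℝ) else 0)
        = 1 + if j = i then 1 else 0 := by
      intro j hj
      rcases lt_trichotomy (h j) (h i) with hlt | heq | hgt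
      · have : j ≠ i := by rintro rfl; exact lt_irrefl _ hlt
        simp [hlt.le, hlt.not_ge, this]
      · simp [hh hj hi heq]
      · have : j ≠ i := by rintro rfl; exact lt_irrefl _ hgt
        simp [hgt.le, hgt.not_ge, this]
    rw [Finset.sum_congr rfl this, Finset.sum_add_distrib]
    simp [hi]
  rw [Finset.sum_congr rfl e2]
  simp
  ring

/-- A finite set can be enumerated increasingly with respect to an injective function. -/
theorem exists_sorted_enumeration {ι : Type} (S : Finset ι) (h : ι → ℝ) (hh : Set.InjOn h S)
    {r : ℕ} (hr : S.card = r) :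
    ∃ e : Fin r → ι, (∀ y, e y ∈ S) ∧ (∀ i ∈ S, ∃ y, e y = i) ∧ StrictMono (h ∘ e) := by
  have hcard : (S.image h).card = r := by rw [Finset.card_image_of_injOn hh, hr]
  set f := (S.image h).orderEmbOfFin hcard with hf
  have hmem : ∀ y, ∃ i ∈ S, h i = f y := fun y => by
    exact Finset.mem_image.1 (Finset.orderEmbOfFin_mem (S.image h) hcard y)
  choose e he1 he2 using hmem
  refine ⟨e, he1, ?_, ?_⟩
  · intro i hi
    have : h i ∈ Set.range f := by
      rw [hf, Finset.range_orderEmbOfFin]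
      simpa using ⟨i, hi, rfl⟩
    obtain ⟨y, hy⟩ := this
    exact ⟨y, hh (he1 y) hi (by rw [he2, hy])⟩
  · intro y z hyz
    simp only [Function.comp, he2]
    exact f.strictMono hyz

namespace ArcSystem

variable {ι : Type} [Fintype ι] {c : ℝ} {r : ℕ} (F : ArcSystem ι c r)

/-- The point `x` is not a lift of an endpoint. -/
def Generic (x : ℝ) : Prop := ∀ i (k : ℤ), x ≠ F.a i + k * c ∧ x ≠ F.b i + k * c

/-- The arcs containing the class of `x` in their interior. -/
def through (x : ℝ) : Finset ι :=
  Finset.univ.filter fun i => ∃ k : ℤ, F.a i + k * c < x ∧ x < F.b i + k * c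

/-- The arc `i` ends inside the arc `j`, which starts inside the arc `i`. -/
def Overlap (i j : ι) : Prop :=
  ∃ k : ℤ, F.a i < F.a j + k * c ∧ F.a j + k * c < F.b i ∧ F.b i < F.b j + k * c

/-- The arc `j` starts where the arc `i` ends. -/
def Touch (i j : ι) : Prop := ∃ k : ℤ, F.a j + k * c = F.b i

/-- The contribution of an ordered pair of arcs to the area. -/
def weight (i j : ι) : ℝ := if F.Overlap i j then 1 else if F.Touch i j then 1 / 2 else 0

/-- The total weight of the ordered pairs of arcs. -/
def area : ℝ := ∑ i, ∑ j, F.weight i j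

/-- The shift whose lift of the arc `i` contains `x`. -/
def shift (x : ℝ) (i : ι) : ℤ :=
  if h : ∃ k : ℤ, F.a i + k * c < x ∧ x < F.b i + k * c then h.choose else 0

/-- The initial endpoint of the lift of the arc `i` containing `x`. -/
def lo (x : ℝ) (i : ι) : ℝ := F.a i + F.shift x i * c

/-- The terminal endpoint of the lift of the arc `i` containing `x`. -/
def hi (x : ℝ) (i : ι) : ℝ := F.b i + F.shift x i * c

theorem mem_through {x : ℝ} {i : ι} :
    i ∈ F.through x ↔ ∃ k : ℤ, F.a i + k * c < x ∧ x < F.b i + k * c := by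
  simp [through]

theorem lo_hi_spec {x : ℝ} {i : ι} (h : i ∈ F.through x) : F.lo x i < x ∧ x < F.hi x i := by
  have h' := F.mem_through.1 h
  simp only [lo, hi, shift, dif_pos h']
  exact h'.choose_spec

theorem hi_lt_lo_add (x : ℝ) (i : ι) : F.hi x i < F.lo x i + c := by
  have := F.width_lt i
  unfold hi lo
  linarith

theorem shift_eq {x : ℝ} {i : ι} {k : ℤ} (h1 : F.a i + k * c < x) (h2 : x < F.b i + k * c) :
    F.shift x i = k := by
  have h := F.lo_hi_spec (F.mem_through.2 ⟨k, h1, h2⟩)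
  have := F.width_lt i
  unfold lo hi at h
  apply le_antisymm <;> apply int_le_of_mul_lt F.pos <;> linarith [h.1, h.2]

theorem lo_add_shift (x : ℝ) (i : ι) (m : ℤ) :
    F.lo x i + m * c = F.a i + ((F.shift x i + m : ℤ) : ℝ) * c := by
  unfold lo; push_cast; ring

theorem hi_add_shift (x : ℝ) (i : ι) (m : ℤ) :
    F.hi x i + m * c = F.b i + ((F.shift x i + m : ℤ) : ℝ) * c := by
  unfold hi; push_cast; ring

/-- Two lifts of arcs do not cover a full period. -/
theorem not_cover_lift (x y : ℝ) (i j : ι) (m : ℤ) (h : F.lo y j + m * c ≤ F.hi x i) :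
    F.hi y j + m * c < F.lo x i + c := by
  rw [lo_add_shift] at h
  rw [hi_add_shift]
  exact F.not_cover i j _ _ h

theorem generic_add {x : ℝ} (hx : F.Generic x) : F.Generic (x + c) := by
  intro i k
  have := hx i (k - 1)
  push_cast at this
  exact ⟨fun h => this.1 (by linarith), fun h => this.2 (by linarith)⟩

theorem through_add (x : ℝ) : F.through (x + c) = F.through x := by
  ext i
  rw [mem_through, mem_through]
  constructor
  · rintro ⟨k, h1, h2⟩
    exact ⟨k - 1, by push_cast; linarith, by push_cast; linarith⟩
  · rintro ⟨k, h1, h2⟩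
    exact ⟨k + 1, by push_cast; linarith, by push_cast; linarith⟩

theorem shift_add {x : ℝ} {i : ι} (h : i ∈ F.through x) : F.shift (x + c) i = F.shift x i + 1 := by
  have := F.lo_hi_spec h
  unfold lo hi at this
  exact F.shift_eq (by push_cast; linarith [this.1]) (by push_cast; linarith [this.2])

theorem lo_add {x : ℝ} {i : ι} (h : i ∈ F.through x) : F.lo (x + c) i = F.lo x i + c := by
  unfold lo; rw [F.shift_add h]; push_cast; ring

theorem lo_injOn (x : ℝ) : Set.InjOn (F.lo x) (F.through x) := fun i _ j _ h =>
  F.a_inj i j _ _ h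

theorem hi_injOn (x : ℝ) : Set.InjOn (F.hi x) (F.through x) := fun i _ j _ h =>
  F.b_inj i j _ _ h

theorem weight_nonneg (i j : ι) : 0 ≤ F.weight i j := by
  unfold weight; split_ifs <;> norm_num

theorem weight_le_one (i j : ι) : F.weight i j ≤ 1 := by
  unfold weight; split_ifs <;> norm_num

/-- The overlap relation can be tested on any lift of the first arc. -/
theorem overlap_iff_lift (x : ℝ) (i j : ι) : F.Overlap i j ↔ ∃ k : ℤ, F.lo x i < F.a j + k * c ∧
    F.a j + k * c < F.hi x i ∧ F.hi x i < F.b j + k * c := by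
  unfold lo hi
  constructor
  · rintro ⟨k, h1, h2, h3⟩
    refine ⟨k + F.shift x i, ?_, ?_, ?_⟩ <;> push_cast <;> linarith
  · rintro ⟨k, h1, h2, h3⟩
    refine ⟨k - F.shift x i, ?_, ?_, ?_⟩ <;> push_cast <;> linarith

theorem touch_iff_lift (x : ℝ) (i j : ι) :
    F.Touch i j ↔ ∃ k : ℤ, F.a j + k * c = F.hi x i := by
  unfold hi
  constructor
  · rintro ⟨k, h1⟩
    exact ⟨k + F.shift x i, by push_cast; linarith⟩
  · rintro ⟨k, h1⟩
    exact ⟨k - F.shift x i, by push_cast; linarith⟩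

theorem lo_ne {x y : ℝ} (hy : F.Generic y) (i : ι) (m : ℤ) : y ≠ F.lo x i + m * c := by
  rw [lo_add_shift]; exact (hy i _).1

theorem hi_ne {x y : ℝ} (hy : F.Generic y) (i : ι) (m : ℤ) : y ≠ F.hi x i + m * c := by
  rw [hi_add_shift]; exact (hy i _).2

theorem mem_through_of_lift {x y : ℝ} {i : ι} (m : ℤ) (h1 : F.lo x i + m * c < y)
    (h2 : y < F.hi x i + m * c) : i ∈ F.through y := by
  rw [lo_add_shift] at h1
  rw [hi_add_shift] at h2
  exact F.mem_through.2 ⟨_, h1, h2⟩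

/-- Arcs through `p` avoiding `q` stay strictly between `q - c` and `q`. -/
theorem bounds_of_notMem {p q : ℝ} (hq : F.Generic q) (hpq : p < q) (hqp : q < p + c) {i : ι}
    (hmi : i ∈ F.through p) (hmi' : i ∉ F.through q) : F.hi p i < q ∧ q < F.lo p i + c := by
  obtain ⟨h1, h2⟩ := F.lo_hi_spec hmi
  constructor
  · by_contra hcon
    have hne := F.hi_ne (x := p) hq i 0
    simp only [Int.cast_zero, zero_mul, add_zero] at hne
    have : q < F.hi p i := lt_of_le_of_ne (not_lt.1 hcon) hne
    exact hmi' (F.mem_through_of_lift (x := p) 0 (by simp; linarith) (by simpa using this))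
  · by_contra hcon
    have hne := F.lo_ne (x := p) hq i 1
    simp only [Int.cast_one, one_mul] at hne
    have : F.lo p i + c < q := lt_of_le_of_ne (not_lt.1 hcon) hne.symm
    exact hmi' (F.mem_through_of_lift (x := p) 1 (by simpa using this) (by simp; linarith))

/-- Arcs through `q` avoiding `p` stay strictly between `p` and `p + c`. -/
theorem bounds_of_notMem_left {p q : ℝ} (hp : F.Generic p) (hpq : p < q) (hqp : q < p + c) {j : ι}
    (hj : j ∈ F.through q) (hj' : j ∉ F.through p) : p < F.lo q j ∧ F.hi q j < p + c := by
  have := F.bounds_of_notMem (F.generic_add hp) hqp (by linarith) hj (by rwa [through_add])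
  exact ⟨by linarith [this.2], this.1⟩

theorem overlap_iff_of_mem {p q : ℝ} (hp : F.Generic p) (hq : F.Generic q) (hpq : p < q)
    (hqp : q < p + c) {i j : ι} (hmi : i ∈ F.through p) (hmi' : i ∉ F.through q)
    (hj : j ∈ F.through q) (hj' : j ∉ F.through p) :
    F.Overlap i j ↔ F.lo q j < F.hi p i := by
  obtain ⟨b1, b2⟩ := F.bounds_of_notMem hq hpq hqp hmi hmi'
  obtain ⟨b3, b4⟩ := F.bounds_of_notMem_left hp hpq hqp hj hj'
  obtain ⟨h1, h2⟩ := F.lo_hi_spec hmi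
  obtain ⟨h3, h4⟩ := F.lo_hi_spec hj
  rw [F.overlap_iff_lift p]
  constructor
  · rintro ⟨k, k1, k2, k3⟩
    have hk : k = F.shift q j := by
      unfold lo at h3 b3 k1 b2
      apply le_antisymm <;> apply int_le_of_mul_lt F.pos <;> linarith
    subst hk
    exact k2
  · intro h
    exact ⟨F.shift q j, by unfold lo at *; linarith, h, by unfold hi at *; linarith⟩

theorem touch_iff_of_mem {p q : ℝ} (hp : F.Generic p) (hq : F.Generic q) (hpq : p < q)
    (hqp : q < p + c) {i j : ι} (hmi : i ∈ F.through p) (hmi' : i ∉ F.through q)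
    (hj : j ∈ F.through q) (hj' : j ∉ F.through p) :
    F.Touch i j ↔ F.lo q j = F.hi p i := by
  obtain ⟨b1, b2⟩ := F.bounds_of_notMem hq hpq hqp hmi hmi'
  obtain ⟨b3, b4⟩ := F.bounds_of_notMem_left hp hpq hqp hj hj'
  obtain ⟨h1, h2⟩ := F.lo_hi_spec hmi
  obtain ⟨h3, h4⟩ := F.lo_hi_spec hj
  rw [F.touch_iff_lift p]
  constructor
  · rintro ⟨k, k1⟩
    have hk : k = F.shift q j := by
      unfold lo at h3 b3
      apply le_antisymm <;> apply int_le_of_mul_lt F.pos <;> linarith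
    subst hk
    exact k1
  · intro h
    exact ⟨F.shift q j, h⟩

theorem overlap_iff_of_mem_same {x : ℝ} {i j : ι} (hmi : i ∈ F.through x) (hj : j ∈ F.through x) :
    F.Overlap i j ↔ F.lo x i < F.lo x j ∧ F.hi x i < F.hi x j := by
  obtain ⟨h1, h2⟩ := F.lo_hi_spec hmi
  obtain ⟨h3, h4⟩ := F.lo_hi_spec hj
  rw [F.overlap_iff_lift x]
  constructor
  · rintro ⟨k, k1, k2, k3⟩
    have hk : k = F.shift x j := by
      have w1 := F.hi_lt_lo_add x i
      have w2 := F.hi_lt_lo_add x j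
      have hle : F.shift x j ≤ k := by
        have := F.width_lt j
        unfold lo at h3
        apply int_le_of_mul_lt F.pos
        linarith
      refine le_antisymm ?_ hle
      by_contra hcon
      push Not at hcon
      have h5 : ((F.shift x j + 1 : ℤ) : ℝ) ≤ k := by exact_mod_cast hcon
      have h6 : ((F.shift x j + 1 : ℤ) : ℝ) * c ≤ k * c :=
        mul_le_mul_of_nonneg_right h5 F.pos.le
      push_cast at h6
      have h7 := F.not_cover_lift x x i j 1 (by unfold lo hi at *; push_cast; linarith)
      push_cast at h7
      linarith
    subst hk
    exact ⟨k1, k3⟩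
  · rintro ⟨h5, h6⟩
    exact ⟨F.shift x j, h5, by unfold lo hi at *; linarith, h6⟩

theorem not_touch_of_mem_same {x : ℝ} {i j : ι} (hmi : i ∈ F.through x) (hj : j ∈ F.through x) :
    ¬ F.Touch i j := by
  obtain ⟨h1, h2⟩ := F.lo_hi_spec hmi
  obtain ⟨h3, h4⟩ := F.lo_hi_spec hj
  rw [F.touch_iff_lift x]
  rintro ⟨k, k1⟩
  have h5 := F.not_cover i j (F.shift x i) k k1.le
  have hk : k ≤ F.shift x j := by
    unfold lo hi at *
    apply int_le_of_mul_lt F.pos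
    linarith
  have h5 : (k : ℝ) ≤ F.shift x j := by exact_mod_cast hk
  have h6 := mul_le_mul_of_nonneg_right h5 F.pos.le
  unfold lo hi at *
  linarith

theorem weight_same {x : ℝ} {i j : ι} (hmi : i ∈ F.through x) (hj : j ∈ F.through x) :
    F.weight i j = if F.lo x i < F.lo x j ∧ F.hi x i < F.hi x j then 1 else 0 := by
  unfold weight
  rw [if_neg (F.not_touch_of_mem_same hmi hj)]
  simp only [F.overlap_iff_of_mem_same hmi hj]

/-- The arc `j` starts inside the arc `i` or at its end, and ends after it. -/
theorem weight_pos_iff (i j : ι) : 0 < F.weight i j ↔ F.Overlap i j ∨ F.Touch i j := by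
  unfold weight
  split_ifs <;> simp_all

/-- Near every point on its right there is a gap without endpoints. -/
theorem exists_gap_right (p q : ℝ) (hpq : p < q) : ∃ y, p < y ∧ y < q ∧ F.Generic y ∧
    ∀ i (k : ℤ), (F.a i + k * c ≤ y → F.a i + k * c ≤ p) ∧
      (F.b i + k * c ≤ y → F.b i + k * c ≤ p) := by
  have key : ∀ t : ℝ, ∀ᶠ y in nhdsWithin p (Set.Ioi p),
      ∀ k : ℤ, t + k * c ≤ y → t + k * c ≤ p := by
    intro t
    have h1 := toIocMod_mem_Ioc F.pos p t
    have h2 : ∀ᶠ y in nhdsWithin p (Set.Ioi p), y < toIocMod F.pos p t :=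
      nhdsWithin_le_nhds (Iio_mem_nhds h1.1)
    filter_upwards [h2] with y hy k hk
    have h3 : t + k * c < toIocMod F.pos p t := lt_of_le_of_lt hk hy
    have h4 := toIocMod_add_toIocDiv_zsmul F.pos p t
    rw [zsmul_eq_mul] at h4
    by_contra hcon
    push Not at hcon
    have e1 : k + toIocDiv F.pos p t ≤ -1 := by
      apply int_le_of_mul_lt F.pos
      push_cast
      linarith
    have e2 : ((k + toIocDiv F.pos p t : ℤ) : ℝ) ≤ ((-1 : ℤ) : ℝ) := by exact_mod_cast e1
    have e3 := mul_le_mul_of_nonneg_right e2 F.pos.le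
    push_cast at e3
    linarith [h1.2]
  have ha : ∀ᶠ y in nhdsWithin p (Set.Ioi p), ∀ i, ∀ k : ℤ, F.a i + k * c ≤ y →
      F.a i + k * c ≤ p := Filter.eventually_all.2 fun i => key (F.a i)
  have hb : ∀ᶠ y in nhdsWithin p (Set.Ioi p), ∀ i, ∀ k : ℤ, F.b i + k * c ≤ y →
      F.b i + k * c ≤ p := Filter.eventually_all.2 fun i => key (F.b i)
  have hq : ∀ᶠ y in nhdsWithin p (Set.Ioi p), y < q := nhdsWithin_le_nhds (Iio_mem_nhds hpq)
  have hp : ∀ᶠ y in nhdsWithin p (Set.Ioi p), p < y := self_mem_nhdsWithin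
  obtain ⟨y, h1, h2, h3, h4⟩ := (ha.and (hb.and (hq.and hp))).exists
  refine ⟨y, h4, h3, fun i k => ⟨fun h => ?_, fun h => ?_⟩, fun i k => ⟨h1 i k, h2 i k⟩⟩
  · linarith [h1 i k h.ge]
  · linarith [h2 i k h.ge]

theorem card_through {x : ℝ} (hx : F.Generic x) : (F.through x).card = r := F.coverage x hx

theorem not_overlap_of_touch {i j : ι} (h : F.Touch i j) : ¬ F.Overlap i j := by
  obtain ⟨k, hk⟩ := h
  rintro ⟨l, h1, h2, h3⟩
  have hlt : (l : ℝ) < k := lt_of_mul_lt_mul_right (by linarith) F.pos.le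
  have hle : (l : ℝ) + 1 ≤ k := by exact_mod_cast hlt
  have := mul_le_mul_of_nonneg_right hle F.pos.le
  linarith [F.width_lt j]

theorem weight_eq_sub (i j : ι) : F.weight i j =
    (if F.Overlap i j ∨ F.Touch i j then 1 else 0) - (if F.Touch i j then 1 else 0) / 2 := by
  unfold weight
  by_cases h : F.Touch i j
  · rw [if_neg (F.not_overlap_of_touch h), if_pos h, if_pos (Or.inr h), if_pos h]
    norm_num
  · simp [h]

/-- The weight of the pairs formed by an arc `i` through `x` and the arcs avoiding `x` to its
right. -/
theorem sum_weight_right {x : ℝ} {i : ι} (hmi : i ∈ F.through x) :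
    ∑ j ∈ (F.through x)ᶜ, F.weight i j +
      (((F.through x).filter fun i' => F.hi x i ≤ F.hi x i').card : ℝ) = r + 1 / 2 := by
  obtain ⟨h1, h2⟩ := F.lo_hi_spec hmi
  obtain ⟨y, y1, y2, y3, y4⟩ := F.exists_gap_right (F.hi x i) (F.lo x i + c) (F.hi_lt_lo_add x i)
  have claim : (F.through y).filter (fun i' => i' ∈ F.through x) =
      (F.through x).filter fun i' => F.hi x i < F.hi x i' := by
    ext i'
    simp only [Finset.mem_filter]
    constructor
    · rintro ⟨m1, m2⟩
      refine ⟨m2, ?_⟩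
      obtain ⟨h3, h4⟩ := F.lo_hi_spec m2
      obtain ⟨k, k1, k2⟩ := F.mem_through.1 m1
      have w := F.hi_lt_lo_add x i'
      rcases lt_trichotomy k (F.shift x i') with hk | hk | hk
      · have e : (k : ℝ) + 1 ≤ F.shift x i' := by exact_mod_cast hk
        have := mul_le_mul_of_nonneg_right e F.pos.le
        unfold lo hi at *
        linarith
      · subst hk
        exact y1.trans k2
      · have e : (F.shift x i' : ℝ) + 1 ≤ k := by exact_mod_cast hk
        have e1 := mul_le_mul_of_nonneg_right e F.pos.le
        have e2 := (y4 i' k).1 k1.le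
        have := F.not_cover_lift x x i i' 1 (by unfold lo at *; push_cast; linarith)
        push_cast at this
        linarith
    · rintro ⟨m2, m3⟩
      obtain ⟨h3, h4⟩ := F.lo_hi_spec m2
      refine ⟨F.mem_through.2 ⟨F.shift x i', ?_, ?_⟩, m2⟩
      · unfold lo at h3; linarith
      · by_contra hcon
        exact absurd ((y4 i' _).2 (not_lt.1 hcon)) (not_le.2 m3)
  have claim' : (F.through y).filter (fun j => ¬ j ∈ F.through x) =
      ((F.through x)ᶜ).filter fun j => F.Overlap i j ∨ F.Touch i j := by
    ext j
    simp only [Finset.mem_filter, Finset.mem_compl]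
    rw [and_comm]
    refine and_congr_right fun hj => ?_
    rw [F.overlap_iff_lift x, F.touch_iff_lift x]
    constructor
    · intro m
      obtain ⟨k, k1, k2⟩ := F.mem_through.1 m
      rcases eq_or_lt_of_le ((y4 j k).1 k1.le) with e | e
      · exact Or.inr ⟨k, e⟩
      · refine Or.inl ⟨k, ?_, e, y1.trans k2⟩
        by_contra hcon
        exact hj (F.mem_through.2 ⟨k, by linarith, by linarith⟩)
    · rintro (⟨k, k1, k2, k3⟩ | ⟨k, k1⟩)
      · refine F.mem_through.2 ⟨k, by linarith, ?_⟩
        by_contra hcon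
        exact absurd ((y4 j k).2 (not_lt.1 hcon)) (not_le.2 k3)
      · refine F.mem_through.2 ⟨k, by linarith, ?_⟩
        by_contra hcon
        have := (y4 j k).2 (not_lt.1 hcon)
        linarith [F.width_pos j]
  have hcard := Finset.card_filter_add_card_filter_not (s := F.through y)
    (fun i' => i' ∈ F.through x)
  rw [claim, claim', F.card_through y3] at hcard
  have hrank : ((F.through x).filter fun i' => F.hi x i ≤ F.hi x i') =
      insert i ((F.through x).filter fun i' => F.hi x i < F.hi x i') := by
    ext i'
    simp only [Finset.mem_filter, Finset.mem_insert]
    constructor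
    · rintro ⟨m, h⟩
      rcases eq_or_lt_of_le h with e | e
      · exact Or.inl (F.hi_injOn x hmi m e).symm
      · exact Or.inr ⟨m, e⟩
    · rintro (rfl | ⟨m, h⟩)
      · exact ⟨hmi, le_rfl⟩
      · exact ⟨m, h.le⟩
  rw [hrank, Finset.card_insert_of_notMem (by simp)]
  have htouch : ∑ j ∈ (F.through x)ᶜ, (if F.Touch i j then (1 : ℝ) else 0) = 1 := by
    obtain ⟨j, k, hk⟩ := F.exists_next i
    have ht : F.Touch i j := ⟨k, hk⟩
    rw [Finset.sum_eq_single j]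
    · rw [if_pos ht]
    · rintro j' _ hne
      rw [if_neg]
      rintro ⟨k', hk'⟩
      exact hne (F.a_inj _ _ _ _ (hk'.trans hk.symm))
    · intro hj
      exact absurd ht (F.not_touch_of_mem_same hmi (by simpa using hj))
  simp only [F.weight_eq_sub]
  rw [Finset.sum_sub_distrib, ← Finset.sum_div, htouch, Finset.sum_boole]
  have : (((F.through x).filter fun i' => F.hi x i < F.hi x i').card : ℝ) +
    (((F.through x)ᶜ).filter fun j => F.Overlap i j ∨ F.Touch i j).card = r := by
    exact_mod_cast hcard
  push_cast
  linarith

/-- The mirror image of an arc system. -/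
def reflect : ArcSystem ι c r where
  a i := -F.b i
  b i := -F.a i
  pos := F.pos
  width_pos i := by linarith [F.width_pos i]
  width_lt i := by linarith [F.width_lt i]
  not_cover i j k l h := by
    have := F.not_cover j i (-l) (-k) (by push_cast; linarith)
    push_cast at this
    linarith
  coverage x hx := by
    refine Eq.trans ?_ (F.coverage (-x) ?_)
    · congr 1
      ext i
      simp only [Finset.mem_filter, Finset.mem_univ, true_and]
      constructor
      · rintro ⟨k, h1, h2⟩
        exact ⟨-k, by push_cast; linarith, by push_cast; linarith⟩
      · rintro ⟨k, h1, h2⟩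
        exact ⟨-k, by push_cast; linarith, by push_cast; linarith⟩
    · intro i k
      have := hx i (-k)
      push_cast at this
      exact ⟨fun h => this.2 (by linarith), fun h => this.1 (by linarith)⟩
  exists_next i := by
    obtain ⟨j, k, h⟩ := F.exists_prev i
    exact ⟨j, -k, by push_cast; linarith⟩
  exists_prev i := by
    obtain ⟨j, k, h⟩ := F.exists_next i
    exact ⟨j, -k, by push_cast; linarith⟩
  a_inj i j k l h := F.b_inj i j (-k) (-l) (by push_cast; linarith)
  b_inj i j k l h := F.a_inj i j (-k) (-l) (by push_cast; linarith)

theorem generic_reflect {x : ℝ} : F.reflect.Generic x ↔ F.Generic (-x) := by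
  constructor <;> intro hx i k <;> have := hx i (-k) <;>
    simp only [reflect] at this ⊢ <;> push_cast at this <;>
    exact ⟨fun h => this.2 (by linarith), fun h => this.1 (by linarith)⟩

theorem through_reflect (x : ℝ) : F.reflect.through x = F.through (-x) := by
  ext i
  rw [mem_through, mem_through]
  constructor <;> rintro ⟨k, h1, h2⟩ <;> simp only [reflect] at h1 h2 ⊢ <;>
    exact ⟨-k, by push_cast; linarith, by push_cast; linarith⟩

theorem hi_reflect {x : ℝ} {i : ι} (h : i ∈ F.through (-x)) :
    F.reflect.hi x i = -F.lo (-x) i := by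
  obtain ⟨h1, h2⟩ := F.lo_hi_spec h
  have : F.reflect.shift x i = -F.shift (-x) i := by
    unfold lo hi at *
    apply shift_eq <;> simp only [reflect] <;> push_cast <;> linarith
  unfold lo hi
  rw [this]
  simp only [reflect]
  push_cast
  ring

theorem weight_reflect (i j : ι) : F.reflect.weight i j = F.weight j i := by
  have h1 : F.reflect.Overlap i j ↔ F.Overlap j i := by
    unfold Overlap
    constructor <;> rintro ⟨k, h1, h2, h3⟩ <;> simp only [reflect] at h1 h2 h3 ⊢ <;>
      refine ⟨k, ?_, ?_, ?_⟩ <;> linarith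
  have h2 : F.reflect.Touch i j ↔ F.Touch j i := by
    unfold Touch
    constructor <;> rintro ⟨k, h1⟩ <;> simp only [reflect] at h1 ⊢ <;>
      exact ⟨k, by linarith⟩
  unfold weight
  simp only [h1, h2]

/-- The weight of the pairs formed by an arc `j` through `x` and the arcs avoiding `x` to its
left. -/
theorem sum_weight_left {x : ℝ} {j : ι} (hmj : j ∈ F.through x) :
    ∑ i ∈ (F.through x)ᶜ, F.weight i j +
      (((F.through x).filter fun j' => F.lo x j' ≤ F.lo x j).card : ℝ) = r + 1 / 2 := by
  have h := F.reflect.sum_weight_right (x := -x) (i := j)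
    (by rwa [through_reflect, neg_neg])
  have hmj' : j ∈ F.through (-(-x)) := by rwa [neg_neg]
  rw [through_reflect, neg_neg] at h
  simp only [weight_reflect] at h
  rw [← h]
  congr 3
  refine Finset.filter_congr fun j' hj' => ?_
  have hj'' : j' ∈ F.through (-(-x)) := by rwa [neg_neg]
  rw [F.hi_reflect hmj', F.hi_reflect hj'', neg_neg, neg_le_neg_iff]

theorem sum_sum_weight_right {x : ℝ} (hx : F.Generic x) :
    ∑ i ∈ F.through x, ∑ j ∈ (F.through x)ᶜ, F.weight i j = (r : ℝ) ^ 2 / 2 := by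
  have h := two_mul_sum_card_le (F.through x) (fun i => -F.hi x i)
    (fun i hi j hj h => F.hi_injOn x hi hj (neg_injective h))
  simp only [neg_le_neg_iff] at h
  have h2 : ∑ i ∈ F.through x, (∑ j ∈ (F.through x)ᶜ, F.weight i j +
      (((F.through x).filter fun i' => F.hi x i ≤ F.hi x i').card : ℝ)) =
      ∑ i ∈ F.through x, ((r : ℝ) + 1 / 2) :=
    Finset.sum_congr rfl fun i hi => F.sum_weight_right hi
  rw [Finset.sum_add_distrib, Finset.sum_const, nsmul_eq_mul] at h2
  rw [F.card_through hx] at h h2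
  linarith

theorem sum_sum_weight_left {x : ℝ} (hx : F.Generic x) :
    ∑ j ∈ F.through x, ∑ i ∈ (F.through x)ᶜ, F.weight i j = (r : ℝ) ^ 2 / 2 := by
  have h := F.reflect.sum_sum_weight_right (x := -x) (F.generic_reflect.2 (by rwa [neg_neg]))
  simpa only [through_reflect, neg_neg, weight_reflect] using h

/-- Near every point on its left there is a gap without endpoints. -/
theorem exists_gap_left (p q : ℝ) (hpq : q < p) : ∃ y, q < y ∧ y < p ∧ F.Generic y ∧
    ∀ i (k : ℤ), (y ≤ F.a i + k * c → p ≤ F.a i + k * c) ∧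
      (y ≤ F.b i + k * c → p ≤ F.b i + k * c) := by
  obtain ⟨y, h1, h2, h3, h4⟩ := F.reflect.exists_gap_right (-p) (-q) (by linarith)
  refine ⟨-y, by linarith, by linarith, F.generic_reflect.1 h3, fun i k => ?_⟩
  have := h4 i (-k)
  simp only [reflect] at this
  push_cast at this
  exact ⟨fun h => by linarith [this.2 (by linarith)], fun h => by linarith [this.1 (by linarith)]⟩

theorem weight_of_touch {i j : ι} (h : F.Touch i j) : F.weight i j = 1 / 2 := by
  unfold weight
  rw [if_neg (F.not_overlap_of_touch h), if_pos h]

theorem sum_sum_weight_through {x : ℝ} (hx : F.Generic x) :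
    ∑ j ∈ F.through x, ∑ i, F.weight i j =
      (r : ℝ) ^ 2 / 2 + ∑ j ∈ F.through x, ∑ i ∈ F.through x, F.weight i j := by
  rw [← F.sum_sum_weight_left hx, ← Finset.sum_add_distrib]
  exact Finset.sum_congr rfl fun j _ => (Finset.sum_compl_add_sum _ _).symm

theorem half_le_sum_weight (j : ι) : 1 / 2 ≤ ∑ i, F.weight i j := by
  obtain ⟨i, k, hk⟩ := F.exists_prev j
  have ht : F.Touch i j := ⟨-k, by push_cast; linarith⟩
  rw [← F.weight_of_touch ht]
  exact Finset.single_le_sum (fun i _ => F.weight_nonneg i j) (Finset.mem_univ i)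

theorem area_eq_of_disjoint {x y z : ℝ} (hx : F.Generic x) (hy : F.Generic y) (hz : F.Generic z)
    (hxy : Disjoint (F.through x) (F.through y)) (hxz : Disjoint (F.through x) (F.through z))
    (hyz : Disjoint (F.through y) (F.through z)) :
    F.area = 3 * (r : ℝ) ^ 2 / 2 + ∑ j ∈ F.through x, ∑ i ∈ F.through x, F.weight i j +
      ∑ j ∈ F.through y, ∑ i ∈ F.through y, F.weight i j +
      ∑ j ∈ F.through z, ∑ i ∈ F.through z, F.weight i j +
      ∑ j ∈ (F.through x ∪ F.through y ∪ F.through z)ᶜ, ∑ i, F.weight i j := by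
  unfold area
  rw [Finset.sum_comm, ← Finset.sum_add_sum_compl (F.through x ∪ F.through y ∪ F.through z),
    Finset.sum_union (Finset.disjoint_union_left.2 ⟨hxz, hyz⟩), Finset.sum_union hxy,
    F.sum_sum_weight_through hx, F.sum_sum_weight_through hy, F.sum_sum_weight_through hz]
  ring

/-- If every arc passes through one of three points, no arc passes through two of them, and arcs
through the same point carry no mutual weight, then the area is `3 r² / 2`. -/
theorem area_eq_of_nested {x : Fin 3 → ℝ} (hx : ∀ k, F.Generic (x k))
    (hd : ∀ k l, k ≠ l → Disjoint (F.through (x k)) (F.through (x l)))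
    (hcov : ∀ i, ∃ k, i ∈ F.through (x k))
    (hnest : ∀ k, ∑ j ∈ F.through (x k), ∑ i ∈ F.through (x k), F.weight i j = 0) :
    F.area = 3 * (r : ℝ) ^ 2 / 2 := by
  have hcompl : (F.through (x 0) ∪ F.through (x 1) ∪ F.through (x 2))ᶜ = ∅ := by
    rw [Finset.compl_eq_empty_iff, Finset.eq_univ_iff_forall]
    intro i
    obtain ⟨k, hk⟩ := hcov i
    simp only [Finset.mem_union]
    fin_cases k
    · exact Or.inl (Or.inl hk)
    · exact Or.inl (Or.inr hk)
    · exact Or.inr hk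
  rw [F.area_eq_of_disjoint (hx 0) (hx 1) (hx 2) (hd 0 1 (by decide)) (hd 0 2 (by decide))
    (hd 1 2 (by decide)), hnest, hnest, hnest, hcompl, Finset.sum_empty]
  ring

theorem card_union_of_disjoint {x y z : ℝ} (hx : F.Generic x) (hy : F.Generic y)
    (hz : F.Generic z) (hxy : Disjoint (F.through x) (F.through y))
    (hxz : Disjoint (F.through x) (F.through z)) (hyz : Disjoint (F.through y) (F.through z)) :
    (F.through x ∪ F.through y ∪ F.through z).card = 3 * r := by
  rw [Finset.card_union_of_disjoint (Finset.disjoint_union_left.2 ⟨hxz, hyz⟩),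
    Finset.card_union_of_disjoint hxy, F.card_through hx, F.card_through hy, F.card_through hz]
  ring

/-- Three points with disjoint sets of arcs through them bound the area from below. -/
theorem le_area_of_disjoint {x y z : ℝ} (hx : F.Generic x) (hy : F.Generic y) (hz : F.Generic z)
    (hxy : Disjoint (F.through x) (F.through y)) (hxz : Disjoint (F.through x) (F.through z))
    (hyz : Disjoint (F.through y) (F.through z)) :
    3 * (r : ℝ) ^ 2 / 2 ≤ F.area ∧ (F.area = 3 * (r : ℝ) ^ 2 / 2 → Fintype.card ι = 3 * r) := by
  have hcard := F.card_union_of_disjoint hx hy hz hxy hxz hyz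
  have harea := F.area_eq_of_disjoint hx hy hz hxy hxz hyz
  have hnn : ∀ S : Finset ι, 0 ≤ ∑ j ∈ S, ∑ i ∈ S, F.weight i j := fun S =>
    Finset.sum_nonneg fun j _ => Finset.sum_nonneg fun i _ => F.weight_nonneg i j
  have h1 := hnn (F.through x)
  have h2 := hnn (F.through y)
  have h3 := hnn (F.through z)
  have h4 : (((F.through x ∪ F.through y ∪ F.through z)ᶜ).card : ℝ) * (1 / 2) ≤
      ∑ j ∈ (F.through x ∪ F.through y ∪ F.through z)ᶜ, ∑ i, F.weight i j := by
    rw [← nsmul_eq_mul]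
    exact Finset.card_nsmul_le_sum _ _ _ fun j _ => F.half_le_sum_weight j
  have h5 : (0 : ℝ) ≤ ((F.through x ∪ F.through y ∪ F.through z)ᶜ).card := Nat.cast_nonneg _
  refine ⟨by linarith, fun h => ?_⟩
  have h6 : (((F.through x ∪ F.through y ∪ F.through z)ᶜ).card : ℝ) = 0 := by linarith
  have h7 : ((F.through x ∪ F.through y ∪ F.through z)ᶜ).card = 0 := by exact_mod_cast h6
  rw [← Finset.card_add_card_compl (F.through x ∪ F.through y ∪ F.through z), h7, hcard, add_zero]

theorem sum_sum_eq_indicator (U V : Finset ι) (f : ι → ι → ℝ) : ∑ i ∈ U, ∑ j ∈ V, f i j =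
    ∑ i, ∑ j, (if i ∈ U then 1 else 0) * (if j ∈ V then 1 else 0) * f i j := by
  simp only [mul_assoc, ← Finset.mul_sum]
  simp only [ite_mul, one_mul, zero_mul, Finset.sum_ite_mem, Finset.univ_inter]

theorem area_add_ge {p q : ℝ} (hp : F.Generic p) (hq : F.Generic q)
    (hd : Disjoint (F.through p) (F.through q)) :
    2 * (r : ℝ) ^ 2 + (∑ i ∈ F.through p, ∑ j ∈ F.through p, F.weight i j +
      ∑ i ∈ F.through q, ∑ j ∈ F.through q, F.weight i j) ≤
    F.area + (∑ i ∈ F.through p, ∑ j ∈ F.through q, F.weight i j +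
      ∑ i ∈ F.through q, ∑ j ∈ F.through p, F.weight i j) := by
  have h1 := F.sum_sum_weight_right hp
  have h2 := F.sum_sum_weight_right hq
  have h3 := F.sum_sum_weight_left hp
  have h4 := F.sum_sum_weight_left hq
  rw [Finset.sum_comm] at h3 h4
  have key : ∑ i ∈ F.through p, ∑ j ∈ (F.through p)ᶜ, F.weight i j +
      ∑ i ∈ (F.through p)ᶜ, ∑ j ∈ F.through p, F.weight i j +
      ∑ i ∈ F.through q, ∑ j ∈ (F.through q)ᶜ, F.weight i j +
      ∑ i ∈ (F.through q)ᶜ, ∑ j ∈ F.through q, F.weight i j +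
      ∑ i ∈ F.through p, ∑ j ∈ F.through p, F.weight i j +
      ∑ i ∈ F.through q, ∑ j ∈ F.through q, F.weight i j ≤
      F.area + ∑ i ∈ F.through p, ∑ j ∈ F.through q, F.weight i j +
      ∑ i ∈ F.through q, ∑ j ∈ F.through p, F.weight i j := by
    unfold area
    simp only [sum_sum_eq_indicator _ _ F.weight]
    simp only [← Finset.sum_add_distrib]
    refine Finset.sum_le_sum fun i _ => Finset.sum_le_sum fun j _ => ?_
    have hw := F.weight_nonneg i j
    have di : i ∈ F.through p → i ∉ F.through q := fun h => Finset.disjoint_left.1 hd h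
    have dj : j ∈ F.through p → j ∉ F.through q := fun h => Finset.disjoint_left.1 hd h
    by_cases i1 : i ∈ F.through p <;> by_cases i2 : i ∈ F.through q <;>
      by_cases j1 : j ∈ F.through p <;> by_cases j2 : j ∈ F.through q <;>
      simp_all
  linarith

theorem weight_pos_iff_of_mem {p q : ℝ} (hp : F.Generic p) (hq : F.Generic q) (hpq : p < q)
    (hqp : q < p + c) (hd : Disjoint (F.through p) (F.through q)) {i j : ι}
    (hmi : i ∈ F.through p) (hmj : j ∈ F.through q) :
    0 < F.weight i j ↔ F.lo q j ≤ F.hi p i := by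
  have hmi' := Finset.disjoint_left.1 hd hmi
  have hmj' := Finset.disjoint_right.1 hd hmj
  rw [weight_pos_iff, F.overlap_iff_of_mem hp hq hpq hqp hmi hmi' hmj hmj',
    F.touch_iff_of_mem hp hq hpq hqp hmi hmi' hmj hmj', le_iff_lt_or_eq]

theorem weight_pos_iff_of_mem_swap {p q : ℝ} (hp : F.Generic p) (hq : F.Generic q) (hpq : p < q)
    (hqp : q < p + c) (hd : Disjoint (F.through p) (F.through q)) {i j : ι}
    (hmi : i ∈ F.through q) (hmj : j ∈ F.through p) :
    0 < F.weight i j ↔ F.lo p j + c ≤ F.hi q i := by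
  rw [← F.lo_add hmj]
  exact F.weight_pos_iff_of_mem hq (F.generic_add hp) hqp (by linarith)
    (by rw [through_add]; exact hd.symm) hmi (by rwa [through_add])

/-- If `β` passes through `p` and `α` through `q`, then one of them overlaps everything linked to
the other one. -/
theorem overlap_dichotomy {p q : ℝ} (hp : F.Generic p) (hq : F.Generic q) (hpq : p < q)
    (hqp : q < p + c) (hd : Disjoint (F.through p) (F.through q)) {α β : ι}
    (hβ : β ∈ F.through p) (hα : α ∈ F.through q) :
    (∀ β' ∈ F.through p, 0 < F.weight β' α → F.weight β β' = 1) ∨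
      ∀ α' ∈ F.through q, 0 < F.weight α' β → F.weight α α' = 1 := by
  by_contra hcon
  push Not at hcon
  obtain ⟨⟨β', hβ', w1, w2⟩, α', hα', w3, w4⟩ := hcon
  rw [F.weight_pos_iff_of_mem hp hq hpq hqp hd hβ' hα] at w1
  rw [F.weight_pos_iff_of_mem_swap hp hq hpq hqp hd hα' hβ] at w3
  rw [F.weight_same hβ hβ'] at w2
  rw [F.weight_same hα hα'] at w4
  have w2' : ¬ (F.lo p β < F.lo p β' ∧ F.hi p β < F.hi p β') := fun h => w2 (if_pos h)
  have w4' : ¬ (F.lo q α < F.lo q α' ∧ F.hi q α < F.hi q α') := fun h => w4 (if_pos h)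
  have n1 := F.not_cover_lift q p α' β 1
  have n2 := F.not_cover_lift p q β' α 0
  have n3 := F.not_cover_lift p q β' α' 0
  have n4 := F.not_cover_lift p q β α 0
  simp only [Int.cast_one, one_mul, Int.cast_zero, zero_mul, add_zero] at n1 n2 n3 n4
  have m1 := n1 w3
  have m2 := n2 w1
  rw [not_and_or, not_lt, not_lt] at w2' w4'
  rcases w2' with h | h <;> rcases w4' with h' | h'
  · linarith [n3 (by linarith)]
  · linarith
  · linarith
  · linarith [n4 (by linarith)]

theorem sum_weight_le_of_lrank {p q : ℝ} (hd : Disjoint (F.through p) (F.through q)) {α : ι}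
    (hα : α ∈ F.through q) :
    ∑ β ∈ F.through p, F.weight β α +
      (((F.through q).filter fun j => F.lo q j ≤ F.lo q α).card : ℝ) ≤ r + 1 / 2 := by
  rw [← F.sum_weight_left hα]
  gcongr
  · exact fun i _ _ => F.weight_nonneg i α
  · intro i hi
    simpa using Finset.disjoint_left.1 hd hi

theorem sum_weight_le_sum_weight (S : Finset ι) (i j : ι)
    (h : ∀ k ∈ S, 0 < F.weight k i → F.weight j k = 1) :
    ∑ k ∈ S, F.weight k i ≤ ∑ k ∈ S, F.weight j k := by
  refine Finset.sum_le_sum fun k hk => ?_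
  rcases (F.weight_nonneg k i).eq_or_lt with h0 | h0
  · rw [← h0]; exact F.weight_nonneg _ _
  · rw [h k hk h0]; exact F.weight_le_one _ _

theorem sum_weight_add_le {p q : ℝ} (hp : F.Generic p) (hq : F.Generic q) (hpq : p < q)
    (hqp : q < p + c) (hd : Disjoint (F.through p) (F.through q)) {α β : ι} {m : ℕ}
    (hβ : β ∈ F.through p) (hα : α ∈ F.through q)
    (hmβ : ((F.through p).filter fun j => F.lo p j ≤ F.lo p β).card = m)
    (hmα : ((F.through q).filter fun j => F.lo q j ≤ F.lo q α).card = m) :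
    ∑ i ∈ F.through p, F.weight i α + ∑ i ∈ F.through q, F.weight i β ≤
      ∑ j ∈ F.through p, F.weight β j + ∑ j ∈ F.through q, F.weight α j + (r + 1 / 2 - m) := by
  have h1 := F.sum_weight_le_of_lrank hd hα
  have h2 := F.sum_weight_le_of_lrank hd.symm hβ
  rw [hmα] at h1
  rw [hmβ] at h2
  have h3 : 0 ≤ ∑ j ∈ F.through p, F.weight β j := Finset.sum_nonneg fun j _ => F.weight_nonneg _ _
  have h4 : 0 ≤ ∑ j ∈ F.through q, F.weight α j := Finset.sum_nonneg fun j _ => F.weight_nonneg _ _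
  rcases F.overlap_dichotomy hp hq hpq hqp hd hβ hα with h | h
  · linarith [F.sum_weight_le_sum_weight _ _ _ h]
  · linarith [F.sum_weight_le_sum_weight _ _ _ h]

/-- The arcs through `x`, ordered by their initial endpoints. -/
theorem exists_enumeration {x : ℝ} (hx : F.Generic x) : ∃ e : Fin r → ι,
    (∀ y, e y ∈ F.through x) ∧ (∀ f : ι → ℝ, ∑ i ∈ F.through x, f i = ∑ y, f (e y)) ∧
    ∀ y, ((F.through x).filter fun j => F.lo x j ≤ F.lo x (e y)).card = (y : ℕ) + 1 := by
  obtain ⟨e, h1, h2, h3⟩ := exists_sorted_enumeration _ _ (F.lo_injOn x) (F.card_through hx)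
  have hinj : Function.Injective e := fun y z h => h3.injective (by simp [h])
  have himage : F.through x = Finset.univ.image e := by
    ext i
    simp only [Finset.mem_image, Finset.mem_univ, true_and]
    exact ⟨h2 i, fun ⟨y, hy⟩ => hy ▸ h1 y⟩
  refine ⟨e, h1, fun f => ?_, fun y => ?_⟩
  · rw [himage, Finset.sum_image fun y _ z _ h => hinj h]
  · have : ((F.through x).filter fun j => F.lo x j ≤ F.lo x (e y)) = (Finset.Iic y).image e := by
      ext i
      simp only [Finset.mem_filter, Finset.mem_image, Finset.mem_Iic]
      constructor
      · rintro ⟨m1, m2⟩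
        obtain ⟨z, rfl⟩ := h2 i m1
        exact ⟨z, h3.le_iff_le.1 m2, rfl⟩
      · rintro ⟨z, hz, rfl⟩
        exact ⟨h1 z, h3.monotone hz⟩
    rw [this, Finset.card_image_of_injective _ hinj, Fin.card_Iic]

/-- The leftmost arc through `x` overlaps some other arc through `x`. -/
def LeftmostOverlaps (x : ℝ) : Prop := ∃ i ∈ F.through x,
  (∀ j ∈ F.through x, F.lo x i ≤ F.lo x j) ∧ ∃ j ∈ F.through x, F.weight i j = 1

theorem eq_of_leftmost {x : ℝ} {i j : ι} (hmi : i ∈ F.through x) (hmj : j ∈ F.through x)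
    (h1 : ∀ k ∈ F.through x, F.lo x i ≤ F.lo x k) (h2 : ∀ k ∈ F.through x, F.lo x j ≤ F.lo x k) :
    i = j :=
  F.lo_injOn x hmi hmj (le_antisymm (h1 j hmj) (h2 i hmi))

theorem lrank_leftmost {x : ℝ} {i : ι} (hmi : i ∈ F.through x)
    (h : ∀ k ∈ F.through x, F.lo x i ≤ F.lo x k) :
    ((F.through x).filter fun j => F.lo x j ≤ F.lo x i).card = 1 := by
  rw [Finset.card_eq_one]
  refine ⟨i, ?_⟩
  ext j
  simp only [Finset.mem_filter, Finset.mem_singleton]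
  constructor
  · rintro ⟨m, hle⟩
    exact F.lo_injOn x m hmi (le_antisymm hle (h j m))
  · rintro rfl
    exact ⟨hmi, le_rfl⟩

theorem lt_area_or {p q : ℝ} (hr : 0 < r) (hp : F.Generic p) (hq : F.Generic q) (hpq : p < q)
    (hqp : q < p + c) (hd : Disjoint (F.through p) (F.through q)) {α β β' γ : ι}
    (hβ : β ∈ F.through p) (hα : α ∈ F.through q)
    (hβl : ∀ j ∈ F.through p, F.lo p β ≤ F.lo p j) (hαl : ∀ j ∈ F.through q, F.lo q α ≤ F.lo q j)
    (hβ' : β' ∈ F.through p) (hlink : 0 < F.weight β' α) (hγ : γ ∈ F.through q)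
    (htouch : F.Touch γ β) :
    3 * (r : ℝ) ^ 2 / 2 < F.area ∨ F.LeftmostOverlaps p ∧ ¬ F.LeftmostOverlaps q := by
  by_cases hfin : F.LeftmostOverlaps p ∧ ¬ F.LeftmostOverlaps q
  · exact Or.inr hfin
  left
  have hstrict : ∑ i ∈ F.through p, F.weight i α + ∑ i ∈ F.through q, F.weight i β <
      ∑ j ∈ F.through p, F.weight β j + ∑ j ∈ F.through q, F.weight α j + (r + 1 / 2 - 1) := by
    have h1 := F.sum_weight_le_of_lrank hd hα
    have h2 := F.sum_weight_le_of_lrank hd.symm hβ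
    rw [F.lrank_leftmost hα hαl] at h1
    rw [F.lrank_leftmost hβ hβl] at h2
    push_cast at h1 h2
    rcases F.overlap_dichotomy hp hq hpq hqp hd hβ hα with h | h
    · have hov : F.LeftmostOverlaps p := ⟨β, hβ, hβl, β', hβ', h β' hβ' hlink⟩
      obtain ⟨α₀, m0, m1, α', m2, m3⟩ : F.LeftmostOverlaps q := by
        by_contra hcon
        exact hfin ⟨hov, hcon⟩
      obtain rfl := F.eq_of_leftmost hα m0 hαl m1
      have h3 := F.sum_weight_le_sum_weight _ _ _ h
      have h4 := Finset.single_le_sum (fun j _ => F.weight_nonneg α j) m2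
      linarith
    · have h3 : ∑ i ∈ F.through q, F.weight i β < ∑ j ∈ F.through q, F.weight α j := by
        refine Finset.sum_lt_sum (fun k hk => ?_) ⟨γ, hγ, ?_⟩
        · rcases (F.weight_nonneg k β).eq_or_lt with h0 | h0
          · rw [← h0]; exact F.weight_nonneg _ _
          · rw [h k hk h0]; exact F.weight_le_one _ _
        · have := F.weight_of_touch htouch
          rw [h γ hγ (by rw [this]; norm_num), this]
          norm_num
      have h4 : 0 ≤ ∑ j ∈ F.through p, F.weight β j :=
        Finset.sum_nonneg fun j _ => F.weight_nonneg _ _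
      linarith
  obtain ⟨e1, a1, a2, a3⟩ := F.exists_enumeration hp
  obtain ⟨e2, b1, b2, b3⟩ := F.exists_enumeration hq
  have hsum : ∑ y, (∑ i ∈ F.through p, F.weight i (e2 y) + ∑ i ∈ F.through q, F.weight i (e1 y)) <
      ∑ y : Fin r, (∑ j ∈ F.through p, F.weight (e1 y) j + ∑ j ∈ F.through q, F.weight (e2 y) j +
        (r + 1 / 2 - ((y : ℕ) + 1 : ℕ))) := by
    refine Finset.sum_lt_sum (fun y _ => F.sum_weight_add_le hp hq hpq hqp hd (a1 y) (b1 y)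
      (a3 y) (b3 y)) ⟨⟨0, hr⟩, Finset.mem_univ _, ?_⟩
    have leftmost : ∀ {x : ℝ} {i j : ι}, i ∈ F.through x →
        (∀ k ∈ F.through x, F.lo x i ≤ F.lo x k) → j ∈ F.through x →
        ((F.through x).filter fun k => F.lo x k ≤ F.lo x j).card = 1 → j = i := by
      intro x i j hmi hl hmj hc
      obtain ⟨k, hk⟩ := Finset.card_eq_one.1 hc
      have e1 : j ∈ ({k} : Finset ι) := hk ▸ Finset.mem_filter.2 ⟨hmj, le_rfl⟩
      have e2 : i ∈ ({k} : Finset ι) := hk ▸ Finset.mem_filter.2 ⟨hmi, hl j hmj⟩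
      rw [Finset.mem_singleton.1 e1, Finset.mem_singleton.1 e2]
    rw [leftmost hβ hβl (a1 _) (a3 ⟨0, hr⟩), leftmost hα hαl (b1 _) (b3 ⟨0, hr⟩)]
    simpa using hstrict
  have htri : ∑ y : Fin r, ((r : ℝ) + 1 / 2 - ((y : ℕ) + 1 : ℕ)) = (r : ℝ) ^ 2 / 2 := by
    have : ∀ n : ℕ, ∑ y ∈ Finset.range n, ((r : ℝ) + 1 / 2 - (y + 1 : ℕ)) =
        n * r - (n : ℝ) ^ 2 / 2 := by
      intro n
      induction n with
      | zero => simp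
      | succ n ih => rw [Finset.sum_range_succ, ih]; push_cast; ring
    rw [Fin.sum_univ_eq_sum_range fun y => ((r : ℝ) + 1 / 2 - (y + 1 : ℕ)), this]
    ring
  simp only [Finset.sum_add_distrib] at hsum
  rw [htri, ← a2 fun i => ∑ j ∈ F.through p, F.weight i j,
    ← b2 fun i => ∑ j ∈ F.through q, F.weight i j,
    ← a2 fun j => ∑ i ∈ F.through q, F.weight i j,
    ← b2 fun j => ∑ i ∈ F.through p, F.weight i j] at hsum
  have hcomm : ∀ U V : Finset ι, ∑ j ∈ U, ∑ i ∈ V, F.weight i j =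
    ∑ i ∈ V, ∑ j ∈ U, F.weight i j := fun U V => Finset.sum_comm
  rw [hcomm, hcomm (F.through p)] at hsum
  linarith [F.area_add_ge hp hq hd]

theorem area_bound_or {p : ℝ} (hr : 0 < r) (hp : F.Generic p) :
    (3 * (r : ℝ) ^ 2 / 2 ≤ F.area ∧ (F.area = 3 * (r : ℝ) ^ 2 / 2 → Fintype.card ι = 3 * r)) ∨
      ∃ q, F.Generic q ∧ F.LeftmostOverlaps p ∧ ¬ F.LeftmostOverlaps q := by
  have hne : ∀ {x : ℝ}, F.Generic x → (F.through x).Nonempty := fun hx =>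
    Finset.card_pos.1 (by rwa [F.card_through hx])
  obtain ⟨β, hβ, hβl⟩ := Finset.exists_min_image _ (F.lo p) (hne hp)
  obtain ⟨s1, s2⟩ := F.lo_hi_spec hβ
  obtain ⟨q, q1, q2, hq, q3⟩ := F.exists_gap_left (F.lo p β + c) (F.hi p β) (F.hi_lt_lo_add p β)
  have hpq : p < q := by linarith
  have hqp : q < p + c := by linarith
  have hd : Disjoint (F.through p) (F.through q) := by
    rw [Finset.disjoint_left]
    intro i hmi hmi'
    obtain ⟨t1, t2⟩ := F.lo_hi_spec hmi
    obtain ⟨k, k1, k2⟩ := F.mem_through.1 hmi'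
    rcases lt_or_ge (F.shift p i) k with hk | hk
    · have e : (F.shift p i : ℝ) + 1 ≤ k := by exact_mod_cast hk
      have := mul_le_mul_of_nonneg_right e F.pos.le
      have := hβl i hmi
      unfold lo at *
      linarith
    · have e : (k : ℝ) ≤ F.shift p i := by exact_mod_cast hk
      have := mul_le_mul_of_nonneg_right e F.pos.le
      have h1 := (q3 i k).2 k2.le
      have h2 := F.not_cover_lift p p i β 1 (by unfold lo hi at *; push_cast; linarith)
      push_cast at h2
      linarith
  obtain ⟨γ, k, hk⟩ := F.exists_prev β
  have htouch : F.Touch γ β := ⟨-k, by push_cast; linarith⟩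
  have hγ : γ ∈ F.through q := by
    have e : F.b γ + ((k + F.shift p β + 1 : ℤ) : ℝ) * c = F.lo p β + c := by
      unfold lo; push_cast; linarith
    refine F.mem_through.2 ⟨k + F.shift p β + 1, ?_, by linarith⟩
    by_contra hcon
    have := (q3 γ _).1 (not_lt.1 hcon)
    linarith [F.width_pos γ]
  obtain ⟨α, hα, hαl⟩ := Finset.exists_min_image _ (F.lo q) (hne hq)
  obtain ⟨β', hβ', hβm⟩ := Finset.exists_max_image _ (F.hi p) (hne hp)
  rcases le_or_gt (F.lo q α) (F.hi p β') with hle | hlt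
  · have hlink := (F.weight_pos_iff_of_mem hp hq hpq hqp hd hβ' hα).2 hle
    rcases F.lt_area_or hr hp hq hpq hqp hd hβ hα hβl hαl hβ' hlink hγ htouch with h | h
    · exact Or.inl ⟨h.le, fun h' => absurd h' h.ne'⟩
    · exact Or.inr ⟨q, hq, h⟩
  · left
    obtain ⟨z, z1, z2, hz, -⟩ := F.exists_gap_right _ _ hlt
    have hpz : Disjoint (F.through p) (F.through z) := by
      rw [Finset.disjoint_left]
      intro i hmi hmi'
      obtain ⟨k, k1, k2⟩ := F.mem_through.1 hmi'
      rcases lt_or_ge (F.shift p i) k with hk | hk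
      · have e : (F.shift p i : ℝ) + 1 ≤ k := by exact_mod_cast hk
        have := mul_le_mul_of_nonneg_right e F.pos.le
        have := hβl i hmi
        have := F.lo_hi_spec hα
        unfold lo at *
        linarith
      · have e : (k : ℝ) ≤ F.shift p i := by exact_mod_cast hk
        have := mul_le_mul_of_nonneg_right e F.pos.le
        have := hβm i hmi
        unfold hi at *
        linarith
    have hqz : Disjoint (F.through q) (F.through z) := by
      rw [Finset.disjoint_left]
      intro j hmj hmj'
      obtain ⟨k, k1, k2⟩ := F.mem_through.1 hmj'
      have hb := F.bounds_of_notMem_left hp hpq hqp hmj (Finset.disjoint_right.1 hd hmj)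
      rcases lt_or_ge k (F.shift q j) with hk | hk
      · have e : (k : ℝ) + 1 ≤ F.shift q j := by exact_mod_cast hk
        have := mul_le_mul_of_nonneg_right e F.pos.le
        have := (F.lo_hi_spec hβ').2
        unfold hi at *
        linarith
      · have e : (F.shift q j : ℝ) ≤ k := by exact_mod_cast hk
        have := mul_le_mul_of_nonneg_right e F.pos.le
        have := hαl j hmj
        unfold lo at *
        linarith
    exact F.le_area_of_disjoint hp hq hz hd hpz hqz

/-- The area of an arc system is at least `3r²/2`, with equality only for `3r` arcs. -/
theorem area_bound (hr : 0 < r) : 3 * (r : ℝ) ^ 2 / 2 ≤ F.area ∧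
    (F.area = 3 * (r : ℝ) ^ 2 / 2 → Fintype.card ι = 3 * r) := by
  obtain ⟨p, -, -, hp, -⟩ := F.exists_gap_right 0 1 one_pos
  rcases F.area_bound_or hr hp with h | ⟨q, hq, -, h1⟩
  · exact h
  · rcases F.area_bound_or hr hq with h | ⟨z, -, h2, -⟩
    · exact h
    · exact absurd h2 h1

/-- If the arc `i` ends in the arc `j`, then a lift of `i` starting no later than the end of `j`
also ends no later than `j`. -/
theorem lt_of_link {i j : ι} {k : ℤ} (h1 : F.a j + k * c ≤ F.b i) (h2 : F.b i ≤ F.b j + k * c)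
    (l : ℤ) (h3 : F.a i + l * c ≤ F.b j) : F.b i + l * c ≤ F.b j := by
  have h4 := F.not_cover i j 0 k (by push_cast; linarith)
  push_cast at h4
  have h5 : l + k ≤ 0 := by
    apply int_le_of_mul_lt F.pos
    push_cast
    linarith
  have h6 : ((l + k : ℤ) : ℝ) ≤ ((0 : ℤ) : ℝ) := by exact_mod_cast h5
  have h7 := mul_le_mul_of_nonneg_right h6 F.pos.le
  push_cast at h7
  linarith

theorem not_overlap_swap {i j : ι} (h : F.Overlap i j) : ¬ F.Overlap j i := by
  obtain ⟨k, h1, h2, h3⟩ := h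
  rintro ⟨l, h4, h5, h6⟩
  linarith [F.lt_of_link h2.le h3.le l h5.le]

theorem not_touch_swap {i j : ι} (h : F.Touch i j) : ¬ F.Touch j i := by
  obtain ⟨k, h1⟩ := h
  rintro ⟨l, h4⟩
  linarith [F.lt_of_link h1.le (by linarith [F.width_pos j]) l h4.le, F.width_pos i]

theorem not_touch_of_overlap_swap {i j : ι} (h : F.Overlap i j) : ¬ F.Touch j i := by
  obtain ⟨k, h1, h2, h3⟩ := h
  rintro ⟨l, h4⟩
  linarith [F.lt_of_link h2.le h3.le l h4.le, F.width_pos i]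

theorem area_eq_sum (F : ArcSystem ι c r) : F.area =
    (∑ i, ∑ j, if F.Overlap i j ∨ F.Overlap j i then (1 : ℝ) else 0) / 2 +
      (∑ i, ∑ j, if F.Touch i j ∨ F.Touch j i then (1 : ℝ) else 0) / 4 := by
  have h1 : ∀ i j, (if F.Overlap i j ∨ F.Overlap j i then (1 : ℝ) else 0) =
      (if F.Overlap i j then 1 else 0) + if F.Overlap j i then 1 else 0 := by
    intro i j
    by_cases h : F.Overlap i j
    · simp [h, F.not_overlap_swap h]
    · simp [h]
  have h2 : ∀ i j, (if F.Touch i j ∨ F.Touch j i then (1 : ℝ) else 0) =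
      (if F.Touch i j then 1 else 0) + if F.Touch j i then 1 else 0 := by
    intro i j
    by_cases h : F.Touch i j
    · simp [h, F.not_touch_swap h]
    · simp [h]
  have h3 : ∀ i j, F.weight i j =
      (if F.Overlap i j then 1 else 0) + (if F.Touch i j then 1 else 0) / 2 := by
    intro i j
    by_cases h : F.Touch i j
    · simp [weight, h, F.not_overlap_of_touch h]
    · simp [weight, h]
  unfold area
  simp only [h1, h2, h3, Finset.sum_add_distrib]
  rw [Finset.sum_comm (f := fun i j => if F.Overlap j i then (1 : ℝ) else 0),
    Finset.sum_comm (f := fun i j => if F.Touch j i then (1 : ℝ) else 0)]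
  simp only [← Finset.sum_div]
  ring

end ArcSystem

theorem AddCircle.coe_eq_coe_iff_exists {c x y : ℝ} :
    (x : AddCircle c) = y ↔ ∃ k : ℤ, y + k * c = x := by
  rw [← sub_eq_zero, ← AddCircle.coe_sub, AddCircle.coe_eq_zero_iff]
  simp only [zsmul_eq_mul]
  exact exists_congr fun k => ⟨fun h => by linarith, fun h => by linarith⟩

theorem Arc.coe_mem_toSet {c : ℝ} {α : Arc c} {x : ℝ} :
    (x : AddCircle c) ∈ α.toSet ↔ ∃ k : ℤ, α.a + k * c ≤ x ∧ x ≤ α.b + k * c := by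
  unfold Arc.toSet
  constructor
  · rintro ⟨y, ⟨h1, h2⟩, h3⟩
    obtain ⟨k, hk⟩ := AddCircle.coe_eq_coe_iff_exists.1 h3.symm
    exact ⟨k, by linarith, by linarith⟩
  · rintro ⟨k, h1, h2⟩
    exact ⟨x - k * c, ⟨by linarith, by linarith⟩,
      (AddCircle.coe_eq_coe_iff_exists.2 ⟨k, by ring⟩).symm⟩

theorem Arc.exists_lt_iff_coe_mem {c : ℝ} {α : Arc c} {x : ℝ}
    (hx : ∀ k : ℤ, x ≠ α.a + k * c ∧ x ≠ α.b + k * c) :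
    (∃ k : ℤ, α.a + k * c < x ∧ x < α.b + k * c) ↔ (x : AddCircle c) ∈ α.toSet := by
  rw [Arc.coe_mem_toSet]
  exact exists_congr fun k => ⟨fun h => ⟨h.1.le, h.2.le⟩, fun h =>
    ⟨lt_of_le_of_ne h.1 (hx k).1.symm, lt_of_le_of_ne h.2 (hx k).2⟩⟩

theorem Arc.union_eq_univ {c : ℝ} (hc : 0 < c) {α β : Arc c} {k l : ℤ}
    (h1 : β.a + l * c ≤ α.b + k * c) (h2 : α.a + k * c + c ≤ β.b + l * c) :
    α.toSet ∪ β.toSet = Set.univ := by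
  refine Set.eq_univ_of_forall fun p => ?_
  induction p using QuotientAddGroup.induction_on with
  | H x =>
    have m := toIcoMod_mem_Ico hc (α.a + k * c) x
    have e : (x : AddCircle c) = (toIcoMod hc (α.a + k * c) x : ℝ) := by
      rw [AddCircle.coe_eq_coe_iff_exists]
      refine ⟨toIcoDiv hc (α.a + k * c) x, ?_⟩
      have := toIcoMod_add_toIcoDiv_zsmul hc (α.a + k * c) x
      rwa [zsmul_eq_mul] at this
    change (x : AddCircle c) ∈ _
    rw [e, Set.mem_union, Arc.coe_mem_toSet, Arc.coe_mem_toSet]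
    rcases le_total (toIcoMod hc (α.a + k * c) x) (α.b + k * c) with h | h
    · exact Or.inl ⟨k, m.1, h⟩
    · exact Or.inr ⟨l, by linarith, by linarith [m.2]⟩

theorem natCard_mem_and {α : Type} (I : Finset α) (P : α → Prop) :
    Nat.card {a // a ∈ I ∧ P a} = (Finset.univ.filter fun i : I => P i).card := by
  rw [← Fintype.card_subtype, ← Nat.card_eq_fintype_card]
  exact Nat.card_congr (Equiv.subtypeSubtypeEquivSubtypeInter (· ∈ I) P).symm

theorem natCard_pairs {α : Type} (I : Finset α) (R : α → α → Prop) :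
    (Nat.card {p : α × α // p.1 ∈ I ∧ p.2 ∈ I ∧ R p.1 p.2} : ℝ) =
      ∑ i : I, ∑ j : I, if R i j then 1 else 0 := by
  have e : Nat.card {p : α × α // p.1 ∈ I ∧ p.2 ∈ I ∧ R p.1 p.2} =
      ((I ×ˢ I).filter fun p => R p.1 p.2).card := by
    rw [← Fintype.card_coe, ← Nat.card_eq_fintype_card]
    exact Nat.card_congr (Equiv.subtypeEquivRight fun p => by simp [and_assoc])
  rw [e, Finset.card_filter, Finset.sum_product]
  push_cast
  rw [← Finset.sum_coe_sort]
  exact Finset.sum_congr rfl fun i _ =>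
    (Finset.sum_coe_sort I fun j => if R i j then (1 : ℝ) else 0).symm

namespace IsDiskFamily

variable {c : ℝ} {r : ℕ} {I : Finset (Arc c)}

theorem existsUnique_term (h : IsDiskFamily r I) {p : AddCircle c} (hp : ∃ α ∈ I, p ∈ α.endpoints) :
    ∃! i : I, i.1.term = p := by
  obtain ⟨⟨h1⟩, ⟨α, h2, h3⟩⟩ := Nat.card_eq_one_iff_unique.1 (h.2.2.2 p hp).1
  refine ⟨⟨α, h2⟩, h3, fun j hj => ?_⟩
  have := h1 ⟨j, j.2, hj⟩ ⟨α, h2, h3⟩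
  simpa [Subtype.ext_iff] using this

theorem existsUnique_init (h : IsDiskFamily r I) {p : AddCircle c} (hp : ∃ α ∈ I, p ∈ α.endpoints) :
    ∃! i : I, i.1.init = p := by
  obtain ⟨⟨h1⟩, ⟨α, h2, h3⟩⟩ := Nat.card_eq_one_iff_unique.1 (h.2.2.2 p hp).2.1
  refine ⟨⟨α, h2⟩, h3, fun j hj => ?_⟩
  have := h1 ⟨j, j.2, hj⟩ ⟨α, h2, h3⟩
  simpa [Subtype.ext_iff] using this

/-- The lifts of the arcs of an `r`-disk family. -/
def toArcSystem (h : IsDiskFamily r I) : ArcSystem I c r where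
  a i := i.1.a
  b i := i.1.b
  pos := h.1
  width_pos i := by linarith [i.1.width_pos]
  width_lt i := by linarith [i.1.width_lt]
  not_cover i j k l h1 := by
    by_contra hcon
    exact h.2.1 i i.2 j j.2 (Arc.union_eq_univ h.1 h1 (not_lt.1 hcon))
  coverage x hx := by
    have hp : ∀ α ∈ I, (x : AddCircle c) ∉ α.endpoints := by
      rintro α hα (hm | hm)
      · obtain ⟨k, hk⟩ := AddCircle.coe_eq_coe_iff_exists.1 hm
        exact (hx ⟨α, hα⟩ k).1 hk.symm
      · obtain ⟨k, hk⟩ := AddCircle.coe_eq_coe_iff_exists.1 hm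
        exact (hx ⟨α, hα⟩ k).2 hk.symm
    refine Eq.trans ?_ (h.2.2.1 x hp)
    rw [natCard_mem_and I fun α => (x : AddCircle c) ∈ α.toSet]
    congr 1
    ext i
    simp only [Finset.mem_filter, Finset.mem_univ, true_and]
    exact Arc.exists_lt_iff_coe_mem (hx i)
  exists_next i := by
    obtain ⟨j, hj, -⟩ := h.existsUnique_init (p := i.1.term) ⟨i, i.2, Or.inr rfl⟩
    obtain ⟨k, hk⟩ := AddCircle.coe_eq_coe_iff_exists.1 hj.symm
    exact ⟨j, k, hk⟩
  exists_prev j := by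
    obtain ⟨i, hi, -⟩ := h.existsUnique_term (p := j.1.init) ⟨j, j.2, Or.inl rfl⟩
    obtain ⟨k, hk⟩ := AddCircle.coe_eq_coe_iff_exists.1 hi.symm
    exact ⟨i, k, hk⟩
  a_inj i j k l hkl := by
    have e : j.1.init = i.1.init :=
      AddCircle.coe_eq_coe_iff_exists.2 ⟨k - l, by push_cast; linarith⟩
    exact (h.existsUnique_init (p := i.1.init) ⟨i, i.2, Or.inl rfl⟩).unique rfl e
  b_inj i j k l hkl := by
    have e : j.1.term = i.1.term :=
      AddCircle.coe_eq_coe_iff_exists.2 ⟨k - l, by push_cast; linarith⟩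
    exact (h.existsUnique_term (p := i.1.term) ⟨i, i.2, Or.inr rfl⟩).unique rfl e

theorem touch_iff (h : IsDiskFamily r I) (i j : I) :
    h.toArcSystem.Touch i j ↔ i.1.term = j.1.init :=
  AddCircle.coe_eq_coe_iff_exists.symm

theorem touch_or_touch_iff (h : IsDiskFamily r I) (i j : I) :
    h.toArcSystem.Touch i j ∨ h.toArcSystem.Touch j i ↔
      i.1 ≠ j.1 ∧ i.1.SharesEndpoint j.1 := by
  have hself : ∀ i, ¬ h.toArcSystem.Touch i i := fun i hi => h.toArcSystem.not_touch_swap hi hi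
  constructor
  · intro ht
    constructor
    · intro e
      obtain rfl := Subtype.ext e
      exact hself _ (ht.elim id id)
    · rcases ht with ht | ht
      · exact ⟨i.1.term, Or.inr rfl, Or.inl ((h.touch_iff i j).1 ht)⟩
      · exact ⟨i.1.init, Or.inl rfl, Or.inr ((h.touch_iff j i).1 ht).symm⟩
  · rintro ⟨hne, p, h1 | h1, h2 | h2⟩
    · have := (h.existsUnique_init (p := p) ⟨i, i.2, Or.inl h1⟩).unique h1.symm h2.symm
      exact absurd (congrArg Subtype.val this) hne
    · exact Or.inr ((h.touch_iff j i).2 (h2.symm.trans h1))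
    · exact Or.inl ((h.touch_iff i j).2 (h1.symm.trans h2))
    · have := (h.existsUnique_term (p := p) ⟨i, i.2, Or.inr h1⟩).unique h1.symm h2.symm
      exact absurd (congrArg Subtype.val this) hne

theorem crosses_of_overlap (h : IsDiskFamily r I) {i j : I} (ho : h.toArcSystem.Overlap i j) :
    ¬ i.1.SharesEndpoint j.1 ∧ j.1.init ∈ i.1.toSet ∧ j.1.term ∉ i.1.toSet := by
  have hne : i.1 ≠ j.1 := by
    intro e
    obtain rfl := Subtype.ext e
    exact h.toArcSystem.not_overlap_swap ho ho
  refine ⟨fun hs => ?_, ?_, ?_⟩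
  · rcases (h.touch_or_touch_iff i j).2 ⟨hne, hs⟩ with ht | ht
    · exact h.toArcSystem.not_overlap_of_touch ht ho
    · exact h.toArcSystem.not_touch_of_overlap_swap ho ht
  · obtain ⟨k, h1, h2, h3⟩ := ho
    simp only [toArcSystem] at h1 h2 h3
    exact Arc.coe_mem_toSet.2 ⟨-k, by push_cast; linarith, by push_cast; linarith⟩
  · obtain ⟨k, h1, h2, h3⟩ := ho
    intro hm
    obtain ⟨l, h4, h5⟩ := Arc.coe_mem_toSet.1 hm
    have h6 := h.toArcSystem.lt_of_link h2.le h3.le l h4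
    have h7 : j.1.b = i.1.b + l * c := le_antisymm h5 h6
    have : i = j := h.toArcSystem.b_inj i j l 0 (by
      simp only [toArcSystem]; push_cast; linarith)
    exact hne (congrArg Subtype.val this)

theorem overlap_of_xor (h : IsDiskFamily r I) {i j : I} (hs : ¬ i.1.SharesEndpoint j.1)
    (hx : Xor (j.1.init ∈ i.1.toSet) (j.1.term ∈ i.1.toSet)) :
    h.toArcSystem.Overlap i j ∨ h.toArcSystem.Overlap j i := by
  have key : ∀ (x y : ℝ) (k : ℤ), (x : AddCircle c) ∈ i.1.endpoints →
      (y : AddCircle c) ∈ j.1.endpoints → x + k * c ≠ y := fun x y k hx hy e =>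
    hs ⟨_, hx, (AddCircle.coe_eq_coe_iff_exists.2 ⟨k, e⟩ : (y : AddCircle c) = x) ▸ hy⟩
  have wi := i.1.width_pos
  have wj := j.1.width_pos
  have ia : (i.1.a : AddCircle c) ∈ i.1.endpoints := Or.inl rfl
  have ib : (i.1.b : AddCircle c) ∈ i.1.endpoints := Or.inr rfl
  have ja : (j.1.a : AddCircle c) ∈ j.1.endpoints := Or.inl rfl
  have jb : (j.1.b : AddCircle c) ∈ j.1.endpoints := Or.inr rfl
  rcases hx with ⟨m1, m2⟩ | ⟨m1, m2⟩
  · left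
    obtain ⟨k, k1, k2⟩ := Arc.coe_mem_toSet.1 m1
    have k3 := lt_of_le_of_ne k1 (key _ _ k ia ja)
    have k4 := lt_of_le_of_ne k2 (key _ _ k ib ja).symm
    have k5 : i.1.b + k * c < j.1.b := by
      by_contra hcon
      exact m2 (Arc.coe_mem_toSet.2 ⟨k, by linarith, by linarith⟩)
    refine ⟨-k, ?_, ?_, ?_⟩ <;> simp only [toArcSystem] <;> push_cast <;> linarith
  · right
    obtain ⟨k, k1, k2⟩ := Arc.coe_mem_toSet.1 m1
    have k3 := lt_of_le_of_ne k1 (key _ _ k ia jb)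
    have k4 := lt_of_le_of_ne k2 (key _ _ k ib jb).symm
    have k5 : j.1.a < i.1.a + k * c := by
      by_contra hcon
      exact m2 (Arc.coe_mem_toSet.2 ⟨k, by linarith, by linarith⟩)
    exact ⟨k, k5, k3, k4⟩

theorem overlap_or_overlap_iff (h : IsDiskFamily r I) (i j : I) :
    h.toArcSystem.Overlap i j ∨ h.toArcSystem.Overlap j i ↔ i.1.Crosses j.1 := by
  have hsymm : ∀ {α β : Arc c}, α.SharesEndpoint β → β.SharesEndpoint α := fun hs => by
    unfold Arc.SharesEndpoint at *
    rwa [Set.inter_comm]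
  constructor
  · rintro (ho | ho)
    · have := h.crosses_of_overlap ho
      exact ⟨this.1, Or.inl (Or.inl this.2)⟩
    · have := h.crosses_of_overlap ho
      exact ⟨fun hs => this.1 (hsymm hs), Or.inr (Or.inl this.2)⟩
  · rintro ⟨hs, hx | hx⟩
    · exact h.overlap_of_xor hs hx
    · exact (h.overlap_of_xor (fun hs' => hs (hsymm hs')) hx).symm

theorem diskArea_eq (h : IsDiskFamily r I) : diskArea I = h.toArcSystem.area := by
  unfold diskArea
  rw [natCard_pairs I Arc.Crosses, natCard_pairs I fun α β => α ≠ β ∧ α.SharesEndpoint β,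
    ArcSystem.area_eq_sum]
  simp only [h.overlap_or_overlap_iff, h.touch_or_touch_iff]
  congr!

end IsDiskFamily

theorem Arc.inter_eq_singleton {c : ℝ} (hc : 0 < c) {α β : Arc c} {p : AddCircle c}
    (hu : α.toSet ∪ β.toSet ≠ Set.univ) (hα : α.term = p) (hβ : β.init = p) :
    α.toSet ∩ β.toSet = {p} := by
  subst hα
  obtain ⟨k, hk⟩ := AddCircle.coe_eq_coe_iff_exists.1 hβ
  have wα := α.width_pos
  have wβ := β.width_pos
  ext q
  rw [Set.mem_singleton_iff]
  constructor
  · induction q using QuotientAddGroup.induction_on with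
    | H x =>
      rintro ⟨m1, m2⟩
      obtain ⟨l, l1, l2⟩ := Arc.coe_mem_toSet.1 m1
      obtain ⟨m, n1, n2⟩ := Arc.coe_mem_toSet.1 m2
      refine AddCircle.coe_eq_coe_iff_exists.2 ⟨l, le_antisymm ?_ l2⟩
      by_contra hcon
      have h1 : m + k < l := by
        have : ((m + k : ℤ) : ℝ) < l := by
          refine lt_of_mul_lt_mul_right ?_ hc.le
          push_cast
          linarith
        exact_mod_cast this
      have h2 : ((m + k : ℤ) : ℝ) + 1 ≤ l := by exact_mod_cast h1
      have h3 := mul_le_mul_of_nonneg_right h2 hc.le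
      push_cast at h3
      exact hu (Arc.union_eq_univ hc (k := 0) (l := -k) (by push_cast; linarith)
        (by push_cast; linarith))
  · rintro rfl
    exact ⟨Arc.coe_mem_toSet.2 ⟨0, by simp; linarith, by simp⟩,
      hβ ▸ Arc.coe_mem_toSet.2 ⟨0, by simp, by simp; linarith⟩⟩

theorem Int.eq_and_eq_of_mul_add_eq {r u v s t : ℤ} (hs : 0 ≤ s) (hs' : s < r) (ht : 0 ≤ t)
    (ht' : t < r) (h : u * r + s = v * r + t) : u = v ∧ s = t := by
  have huv : u = v := by
    rcases lt_trichotomy u v with hlt | heq | hgt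
    · nlinarith
    · exact heq
    · nlinarith
  subst huv
  exact ⟨rfl, by linarith⟩

/-- The residue of an integer modulo three. -/
def residue (v : ℤ) : Fin 3 := ⟨(v % 3).toNat, by omega⟩

theorem residue_add (v : ℤ) : (residue v : ℤ) + 3 * (v / 3) = v := by
  simp only [residue]
  omega

theorem residue_add_mul (k : Fin 3) (m : ℤ) : residue (k + 3 * m) = k := by
  apply Fin.ext
  simp only [residue]
  omega

/-- The arcs of a model family: three nests of `r` concentric arcs. -/
def modelArc (r : ℕ) (k : Fin 3) (s : Fin r) : Arc (3 * (r : ℝ)) where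
  a := ((k * r + s : ℤ) : ℝ)
  b := ((k * r + 2 * r - 1 - s : ℤ) : ℝ)
  width_pos := by
    have h : (s : ℝ) + 1 ≤ r := by exact_mod_cast s.2
    push_cast
    linarith
  width_lt := by
    have h : (s : ℝ) + 1 ≤ r := by exact_mod_cast s.2
    push_cast
    linarith

section modelArc

variable {r : ℕ}

theorem modelArc_a_add (k : Fin 3) (s : Fin r) (m : ℤ) :
    (modelArc r k s).a + m * (3 * (r : ℝ)) = (((k + 3 * m) * r + s : ℤ) : ℝ) := by
  simp only [modelArc]
  push_cast
  ring

theorem modelArc_b_add (k : Fin 3) (s : Fin r) (m : ℤ) : (modelArc r k s).b + m * (3 * (r : ℝ)) =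
    (((k + 3 * m + 1) * r + Fin.rev s : ℤ) : ℝ) := by
  have h : ((Fin.rev s : ℕ) : ℝ) = r - (s + 1) := by
    rw [Fin.val_rev, Nat.cast_sub (by omega)]
    push_cast
    ring
  simp only [modelArc]
  push_cast
  rw [h]
  ring

theorem modelArc_init_eq_iff {k : Fin 3} {s : Fin r} {v t : ℤ} (ht : 0 ≤ t) (ht' : t < r) :
    (modelArc r k s).init = (((v * r + t : ℤ) : ℝ) : AddCircle (3 * (r : ℝ))) ↔
      k = residue v ∧ (s : ℤ) = t := by
  rw [eq_comm]
  unfold Arc.init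
  rw [AddCircle.coe_eq_coe_iff_exists]
  simp only [modelArc_a_add]
  constructor
  · rintro ⟨m, hm⟩
    obtain ⟨h1, h2⟩ := Int.eq_and_eq_of_mul_add_eq (by omega) (by omega) ht ht'
      (Int.cast_injective hm)
    exact ⟨by rw [← h1, residue_add_mul], h2⟩
  · rintro ⟨rfl, h⟩
    exact ⟨v / 3, by rw [residue_add, h]⟩

theorem modelArc_term_eq_iff {k : Fin 3} {s : Fin r} {v t : ℤ} (ht : 0 ≤ t) (ht' : t < r) :
    (modelArc r k s).term = (((v * r + t : ℤ) : ℝ) : AddCircle (3 * (r : ℝ))) ↔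
      k = residue (v - 1) ∧ ((Fin.rev s : ℕ) : ℤ) = t := by
  rw [eq_comm]
  unfold Arc.term
  rw [AddCircle.coe_eq_coe_iff_exists]
  simp only [modelArc_b_add]
  constructor
  · rintro ⟨m, hm⟩
    obtain ⟨h1, h2⟩ := Int.eq_and_eq_of_mul_add_eq (by omega) (by omega) ht ht'
      (Int.cast_injective hm)
    exact ⟨by rw [← h1, add_sub_cancel_right, residue_add_mul], h2⟩
  · rintro ⟨rfl, h⟩
    exact ⟨(v - 1) / 3, by rw [residue_add, h, sub_add_cancel]⟩

theorem modelArc_injective : Function.Injective fun i : Fin 3 × Fin r => modelArc r i.1 i.2 := by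
  rintro ⟨k, s⟩ ⟨k', s'⟩ h
  have h1 := (modelArc_init_eq_iff (k := k) (s := s) (v := (k' : ℤ)) (t := (s' : ℤ)) (by omega)
    (by omega)).1 (by simp only at h; rw [h]; simp [Arc.init, modelArc])
  have h2 := residue_add_mul k' 0
  rw [mul_zero, add_zero] at h2
  rw [h2] at h1
  exact Prod.ext h1.1 (Fin.ext (by exact_mod_cast h1.2))

/-- Membership of a point with integer part `v * r + t` in an arc of the model family. -/
theorem coe_mem_modelArc_iff {k : Fin 3} {s : Fin r} {x : ℝ} (hx : ∀ n : ℤ, x ≠ n) {v t : ℤ}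
    (ht : 0 ≤ t) (ht' : t < r) (hxt : ⌊x⌋ = v * r + t) :
    (x : AddCircle (3 * (r : ℝ))) ∈ (modelArc r k s).toSet ↔
      k = residue v ∧ (s : ℤ) ≤ t ∨ k = residue (v - 1) ∧ t < (Fin.rev s : ℕ) := by
  rw [Arc.coe_mem_toSet]
  have key : ∀ m : ℤ, ((modelArc r k s).a + m * (3 * (r : ℝ)) ≤ x ∧
      x ≤ (modelArc r k s).b + m * (3 * (r : ℝ))) ↔
      (k + 3 * m) * r + s ≤ v * r + t ∧ v * r + t < (k + 3 * m + 1) * r + (Fin.rev s : ℕ) := by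
    intro m
    rw [modelArc_a_add, modelArc_b_add, ← Int.le_floor, hxt, ← hxt, Int.floor_lt, hxt]
    exact and_congr_right fun _ => ⟨fun h => lt_of_le_of_ne h (hx _), le_of_lt⟩
  simp only [key]
  have hs := s.2
  have hrev := Fin.val_rev s
  constructor
  · rintro ⟨m, h1, h2⟩
    generalize hu : (k : ℤ) + 3 * m = u at h1 h2
    have hk : k = residue u := by rw [← hu, residue_add_mul]
    have h3 : u ≤ v := by
      by_contra hcon
      push Not at hcon
      nlinarith
    have h4 : v - 1 ≤ u := by
      by_contra hcon
      push Not at hcon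
      have : ((Fin.rev s : ℕ) : ℤ) < r := by omega
      nlinarith
    rcases h3.eq_or_lt with rfl | h5
    · exact Or.inl ⟨hk, by linarith⟩
    · obtain rfl : u = v - 1 := by omega
      exact Or.inr ⟨hk, by linarith⟩
  · rintro (⟨rfl, h⟩ | ⟨rfl, h⟩)
    · refine ⟨v / 3, ?_, ?_⟩ <;> rw [residue_add]
      · linarith
      · have : (t : ℤ) < r + (Fin.rev s : ℕ) := by omega
        linarith
    · refine ⟨(v - 1) / 3, ?_, ?_⟩ <;> rw [residue_add]
      · have : (s : ℤ) ≤ r + t := by omega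
        linarith
      · linarith

/-- The model family of `3 * r` arcs. -/
def modelFamily (r : ℕ) : Finset (Arc (3 * (r : ℝ))) :=
  Finset.univ.image fun i : Fin 3 × Fin r => modelArc r i.1 i.2

theorem mem_modelFamily {α : Arc (3 * (r : ℝ))} :
    α ∈ modelFamily r ↔ ∃ k s, modelArc r k s = α := by
  simp [modelFamily]

theorem exists_eq_mul_add (hr : 0 < r) (n : ℤ) : ∃ v t : ℤ, 0 ≤ t ∧ t < r ∧ n = v * r + t :=
  ⟨n / r, n % r, Int.emod_nonneg _ (by omega), Int.emod_lt_of_pos _ (by omega),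
    by rw [mul_comm]; exact (Int.mul_ediv_add_emod n r).symm⟩

/-- The midpoint of the arcs of a nest of the model family. -/
def modelPoint (r : ℕ) (k : Fin 3) : ℝ := ((k * r + (r - 1) : ℤ) : ℝ) + 1 / 2

theorem modelPoint_ne (k : Fin 3) (n : ℤ) : modelPoint r k ≠ n := by
  unfold modelPoint
  intro h
  have h1 : (((2 * (k * r + (r - 1)) + 1 : ℤ)) : ℝ) = ((2 * n : ℤ) : ℝ) := by
    push_cast at h ⊢
    linarith
  have h2 : 2 * ((k : ℤ) * r + (r - 1)) + 1 = 2 * n := by exact_mod_cast h1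
  omega

theorem floor_modelPoint (k : Fin 3) : ⌊modelPoint r k⌋ = k * r + ((r : ℤ) - 1) := by
  unfold modelPoint
  rw [Int.floor_intCast_add]
  norm_num

theorem modelPoint_mem_iff {k l : Fin 3} {s : Fin r} :
    ((modelPoint r l : ℝ) : AddCircle (3 * (r : ℝ))) ∈ (modelArc r k s).toSet ↔ k = l := by
  have hs := s.2
  have hrev := Fin.val_rev s
  rw [coe_mem_modelArc_iff (modelPoint_ne l) (by omega) (by omega) (floor_modelPoint l)]
  have h2 := residue_add_mul l 0
  rw [mul_zero, add_zero] at h2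
  rw [h2]
  constructor
  · rintro (h | h)
    · exact h.1
    · omega
  · intro h
    exact Or.inl ⟨h, by omega⟩

theorem exists_int_of_mem_endpoints {k : Fin 3} {s : Fin r} {p : AddCircle (3 * (r : ℝ))}
    (hp : p ∈ (modelArc r k s).endpoints) : ∃ n : ℤ, p = ((n : ℝ) : AddCircle (3 * (r : ℝ))) := by
  rcases hp with rfl | rfl
  · exact ⟨_, rfl⟩
  · exact ⟨_, rfl⟩

theorem card_modelFamily_through (hr : 0 < r) {x : ℝ} (hx : ∀ n : ℤ, x ≠ n) :
    Nat.card {α // α ∈ modelFamily r ∧ (x : AddCircle (3 * (r : ℝ))) ∈ α.toSet} = r := by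
  obtain ⟨v, t, ht, ht', hxt⟩ := exists_eq_mul_add hr ⌊x⌋
  have hne : residue v ≠ residue (v - 1) := by
    intro h
    have := congrArg Fin.val h
    simp only [residue] at this
    omega
  let f : Fin r → Fin 3 × Fin r := fun s =>
    if (s : ℤ) ≤ t then (residue v, s) else (residue (v - 1), Fin.rev s)
  have hf : Function.Injective f := by
    intro s s' h
    simp only [f] at h
    split_ifs at h with h1 h2 h2
    · exact (Prod.mk.inj h).2
    · exact absurd (Prod.mk.inj h).1 hne
    · exact absurd (Prod.mk.inj h).1.symm hne
    · exact Fin.rev_injective (Prod.mk.inj h).2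
  have himage : ∀ α, α ∈ modelFamily r ∧ (x : AddCircle (3 * (r : ℝ))) ∈ α.toSet ↔
      α ∈ Finset.univ.image fun s => modelArc r (f s).1 (f s).2 := by
    intro α
    rw [mem_modelFamily]
    simp only [Finset.mem_image, Finset.mem_univ, true_and]
    constructor
    · rintro ⟨⟨k, s, rfl⟩, hm⟩
      rcases (coe_mem_modelArc_iff hx ht ht' hxt).1 hm with ⟨rfl, h⟩ | ⟨rfl, h⟩
      · exact ⟨s, by simp only [f, if_pos h]⟩
      · exact ⟨Fin.rev s, by simp only [f, if_neg (not_le.2 h), Fin.rev_rev]⟩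
    · rintro ⟨s, rfl⟩
      refine ⟨⟨_, _, rfl⟩, (coe_mem_modelArc_iff hx ht ht' hxt).2 ?_⟩
      by_cases h : (s : ℤ) ≤ t
      · exact Or.inl (by simp [f, if_pos h, h])
      · exact Or.inr (by simp [f, if_neg h, not_le.1 h])
  rw [Nat.card_congr (Equiv.subtypeEquivRight himage), Nat.card_eq_fintype_card, Fintype.card_coe,
    Finset.card_image_of_injective, Finset.card_univ, Fintype.card_fin]
  exact modelArc_injective.comp hf

theorem isDiskFamily_modelFamily (hr : 0 < r) : IsDiskFamily r (modelFamily r) := by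
  have hc : 0 < 3 * (r : ℝ) := by positivity
  have hunion : ∀ α ∈ modelFamily r, ∀ β ∈ modelFamily r, α.toSet ∪ β.toSet ≠ Set.univ := by
    intro α hα β hβ hu
    obtain ⟨k, s, rfl⟩ := mem_modelFamily.1 hα
    obtain ⟨k', s', rfl⟩ := mem_modelFamily.1 hβ
    have hthird : ∀ k k' : Fin 3, ∃ l, k ≠ l ∧ k' ≠ l := by decide
    obtain ⟨l, h1, h2⟩ := hthird k k'
    have hm : ((modelPoint r l : ℝ) : AddCircle (3 * (r : ℝ))) ∈
        (modelArc r k s).toSet ∪ (modelArc r k' s').toSet := hu ▸ Set.mem_univ _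
    rcases hm with hm | hm
    · exact h1 (modelPoint_mem_iff.1 hm)
    · exact h2 (modelPoint_mem_iff.1 hm)
  refine ⟨hc, hunion, ?_, ?_⟩
  · intro p hp
    induction p using QuotientAddGroup.induction_on with
    | H x =>
      refine card_modelFamily_through hr fun n hn => ?_
      obtain ⟨v, t, ht, ht', rfl⟩ := exists_eq_mul_add hr n
      refine hp (modelArc r (residue v) ⟨t.toNat, by omega⟩) (mem_modelFamily.2 ⟨_, _, rfl⟩)
        (Or.inl ?_)
      change (x : AddCircle (3 * (r : ℝ))) = _
      rw [hn, eq_comm, modelArc_init_eq_iff ht ht']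
      exact ⟨rfl, by simp [ht]⟩
  · rintro p ⟨α, hα, hp⟩
    obtain ⟨k, s, rfl⟩ := mem_modelFamily.1 hα
    obtain ⟨n, rfl⟩ := exists_int_of_mem_endpoints hp
    obtain ⟨v, t, ht, ht', rfl⟩ := exists_eq_mul_add hr n
    refine ⟨?_, ?_, fun α hα β hβ h1 h2 => Arc.inter_eq_singleton hc (hunion α hα β hβ) h1 h2⟩
    · rw [Nat.card_eq_one_iff_unique]
      refine ⟨⟨?_⟩, ⟨⟨modelArc r (residue (v - 1)) (Fin.rev ⟨t.toNat, by omega⟩),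
        mem_modelFamily.2 ⟨_, _, rfl⟩, (modelArc_term_eq_iff ht ht').2 ⟨rfl, by simp [ht]⟩⟩⟩⟩
      rintro ⟨β, hβ, h1⟩ ⟨γ, hγ, h2⟩
      obtain ⟨kβ, sβ, rfl⟩ := mem_modelFamily.1 hβ
      obtain ⟨kγ, sγ, rfl⟩ := mem_modelFamily.1 hγ
      obtain ⟨rfl, h3⟩ := (modelArc_term_eq_iff ht ht').1 h1
      obtain ⟨rfl, h4⟩ := (modelArc_term_eq_iff ht ht').1 h2
      obtain rfl : sβ = sγ := Fin.rev_injective (Fin.ext (by omega))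
      rfl
    · rw [Nat.card_eq_one_iff_unique]
      refine ⟨⟨?_⟩, ⟨⟨modelArc r (residue v) ⟨t.toNat, by omega⟩,
        mem_modelFamily.2 ⟨_, _, rfl⟩, (modelArc_init_eq_iff ht ht').2 ⟨rfl, by simp [ht]⟩⟩⟩⟩
      rintro ⟨β, hβ, h1⟩ ⟨γ, hγ, h2⟩
      obtain ⟨kβ, sβ, rfl⟩ := mem_modelFamily.1 hβ
      obtain ⟨kγ, sγ, rfl⟩ := mem_modelFamily.1 hγ
      obtain ⟨rfl, h3⟩ := (modelArc_init_eq_iff ht ht').1 h1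
      obtain ⟨rfl, h4⟩ := (modelArc_init_eq_iff ht ht').1 h2
      obtain rfl : sβ = sγ := Fin.ext (by omega)
      rfl

theorem diskArea_modelFamily (hr : 0 < r) : diskArea (modelFamily r) = 3 * (r : ℝ) ^ 2 / 2 := by
  have h := isDiskFamily_modelFamily hr
  have hgen : ∀ k, h.toArcSystem.Generic (modelPoint r k) := by
    rintro k ⟨α, hα⟩ m
    obtain ⟨l, s, rfl⟩ := mem_modelFamily.1 hα
    simp only [IsDiskFamily.toArcSystem, modelArc_a_add, modelArc_b_add]
    exact ⟨modelPoint_ne k _, modelPoint_ne k _⟩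
  have hmem : ∀ k i, i ∈ h.toArcSystem.through (modelPoint r k) ↔ ∃ s, modelArc r k s = i := by
    rintro k ⟨α, hα⟩
    obtain ⟨l, s, rfl⟩ := mem_modelFamily.1 hα
    rw [ArcSystem.mem_through]
    refine (Arc.exists_lt_iff_coe_mem (hgen k ⟨_, hα⟩)).trans (modelPoint_mem_iff.trans ?_)
    constructor
    · rintro rfl
      exact ⟨s, rfl⟩
    · rintro ⟨s', hs'⟩
      exact (Prod.mk.inj (modelArc_injective (a₁ := (k, s')) (a₂ := (l, s)) hs')).1.symm
  have hdisj : ∀ k l, k ≠ l → Disjoint (h.toArcSystem.through (modelPoint r k))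
      (h.toArcSystem.through (modelPoint r l)) := by
    intro k l hkl
    rw [Finset.disjoint_left]
    intro i h1 h2
    obtain ⟨s, hs⟩ := (hmem k i).1 h1
    obtain ⟨t, ht⟩ := (hmem l i).1 h2
    exact hkl (Prod.mk.inj (modelArc_injective (a₁ := (k, s)) (a₂ := (l, t)) (hs.trans ht.symm))).1
  have hlift : ∀ k, ∀ i ∈ h.toArcSystem.through (modelPoint r k),
      h.toArcSystem.lo (modelPoint r k) i + h.toArcSystem.hi (modelPoint r k) i =
        2 * (k * r) + 2 * r - 1 := by
    intro k i hi
    obtain ⟨s, hs⟩ := (hmem k i).1 hi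
    have hle : (s : ℝ) + 1 ≤ r := by exact_mod_cast s.2
    have hshift : h.toArcSystem.shift (modelPoint r k) i = 0 := by
      apply ArcSystem.shift_eq <;> simp only [IsDiskFamily.toArcSystem, ← hs, modelArc, modelPoint]
        <;> push_cast <;> linarith
    unfold ArcSystem.lo ArcSystem.hi
    rw [hshift]
    simp only [IsDiskFamily.toArcSystem, ← hs, modelArc]
    push_cast
    ring
  have hnest : ∀ k, ∑ j ∈ h.toArcSystem.through (modelPoint r k),
      ∑ i ∈ h.toArcSystem.through (modelPoint r k), h.toArcSystem.weight i j = 0 := by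
    refine fun k => Finset.sum_eq_zero fun j hj => Finset.sum_eq_zero fun i hi => ?_
    rw [ArcSystem.weight_same _ hi hj, if_neg]
    rintro ⟨h1, h2⟩
    linarith [hlift k i hi, hlift k j hj]
  rw [h.diskArea_eq]
  refine h.toArcSystem.area_eq_of_nested hgen hdisj ?_ hnest
  rintro ⟨α, hα⟩
  obtain ⟨k, s, rfl⟩ := mem_modelFamily.1 hα
  exact ⟨k, (hmem k _).2 ⟨s, rfl⟩⟩

end modelArc

end

/-- **Identity from the proof of Theorem 9.1 of the paper**: an area-minimal `r`-disk
family consisting of `n` arcs has area exactly `n·r/2`. -/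
theorem area_of_minimal (r : ℕ) (hr : 0 < r) {c : ℝ}
    (I : Finset (Arc c)) (hI : IsAreaMinimal r I) :
    diskArea I = (I.card : ℝ) * (r : ℝ) / 2 := by
  have h := hI.1.toArcSystem.area_bound hr
  have hle := hI.2 _ _ (isDiskFamily_modelFamily hr)
  rw [diskArea_modelFamily hr, hI.1.diskArea_eq] at hle
  have heq := le_antisymm hle h.1
  have hcard := h.2 heq
  rw [Fintype.card_coe] at hcard
  rw [hI.1.diskArea_eq, heq, hcard]
  push_cast
  ring
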